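/- arXiv:2410.09593 — 9 statements merged into one kernel-verified Lean document; each statement's English description precedes it below -/
import Mathlib

section
/- Let k be an even positive integer, let x be a real number, and let y > 0 be real. Then the integral over the real line ∫_{-∞}^{∞} e^{2πi x u} (−u + i(y+1))^{−k} du equals ((2πi)^k / Γ(k)) · x^{k−1} e^{−2π x (y+1)} if x ≥ 0, and equals 0 if x < 0. -/
open MeasureTheory

open Set Filter Topology FourierTransform

lemma integrableOn_Ioi_pow_mul_cexp_neg_mul (n : ℕ) {c : ℂ} (hc : 0 < c.re) :
    IntegrableOn (fun t : ℝ => (t : ℂ) ^ n * Complex.exp (-(c * t))) (Ioi 0) := by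
  have h := integrableOn_rpow_mul_exp_neg_mul_rpow (p := 1) (s := n) (b := c.re)
    (by have : (0 : ℝ) ≤ n := n.cast_nonneg
        linarith) one_pos hc
  refine h.mono' (by fun_prop) ((ae_restrict_mem measurableSet_Ioi).mono fun t ht => ?_)
  have ht' : (0 : ℝ) < t := ht
  simp [Complex.norm_exp, abs_of_pos ht']

lemma tendsto_pow_mul_cexp_neg_mul_atTop (n : ℕ) {c : ℂ} (hc : 0 < c.re) :
    Tendsto (fun t : ℝ => (t : ℂ) ^ n * Complex.exp (-(c * t))) atTop (𝓝 0) := by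
  rw [tendsto_zero_iff_norm_tendsto_zero]
  refine (tendsto_rpow_mul_exp_neg_mul_atTop_nhds_zero n c.re hc).congr' ?_
  filter_upwards [eventually_gt_atTop 0] with t ht
  simp [Complex.norm_exp, abs_of_pos ht]

lemma integral_Ioi_pow_mul_cexp_neg_mul (n : ℕ) {c : ℂ} (hc : 0 < c.re) :
    ∫ t : ℝ in Ioi 0, (t : ℂ) ^ n * Complex.exp (-(c * t)) = n.factorial / c ^ (n + 1) := by
  have hc0 : c ≠ 0 := by
    rintro rfl
    simp at hc
  have hexp (t : ℝ) : HasDerivAt (fun t : ℝ => Complex.exp (-(c * t)))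
      (-c * Complex.exp (-(c * t))) t := by
    refine (((hasDerivAt_id t).ofReal_comp.const_mul c).neg).cexp.congr_deriv ?_
    simp [mul_comm]
  induction n with
  | zero =>
    have h := integral_Ioi_of_hasDerivAt_of_tendsto' (a := 0) (m := 0)
      (f := fun t : ℝ => -(Complex.exp (-(c * t)) / c)) (f' := fun t : ℝ => Complex.exp (-(c * t)))
      (fun t _ => by
        refine ((hexp t).div_const c).neg.congr_deriv ?_
        field_simp)
      (by simpa using integrableOn_Ioi_pow_mul_cexp_neg_mul 0 hc)
      (by simpa using ((tendsto_pow_mul_cexp_neg_mul_atTop 0 hc).div_const c).neg)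
    simpa using h
  | succ n ih =>
    have hi := integrableOn_Ioi_pow_mul_cexp_neg_mul (n + 1) hc
    have hi' := (integrableOn_Ioi_pow_mul_cexp_neg_mul n hc).const_mul ((n + 1 : ℂ) / c)
    have h := integral_Ioi_of_hasDerivAt_of_tendsto' (a := 0) (m := 0)
      (f := fun t : ℝ => -((t : ℂ) ^ (n + 1) * Complex.exp (-(c * t)) / c))
      (f' := fun t : ℝ => (t : ℂ) ^ (n + 1) * Complex.exp (-(c * t)) -
        (n + 1 : ℂ) / c * ((t : ℂ) ^ n * Complex.exp (-(c * t))))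
      (fun t _ => by
        have hp : HasDerivAt (fun t : ℝ => (t : ℂ) ^ (n + 1)) ((n + 1 : ℂ) * (t : ℂ) ^ n) t := by
          refine ((hasDerivAt_id t).ofReal_comp.pow (n + 1)).congr_deriv ?_
          simp
        refine ((hp.mul (hexp t)).div_const c).neg.congr_deriv ?_
        field_simp
        ring)
      (hi.sub hi')
      (by simpa using ((tendsto_pow_mul_cexp_neg_mul_atTop (n + 1) hc).div_const c).neg)
    rw [integral_sub hi hi', integral_const_mul, ih] at h
    simp only [Complex.ofReal_zero, ne_eq, Nat.succ_ne_zero, not_false_eq_true, zero_pow, zero_mul,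
      zero_div, neg_zero, sub_zero, sub_eq_zero] at h
    rw [h, Nat.factorial_succ]
    push_cast
    field_simp
    ring

/-- The Fourier transform of a one-sided exponential weighted by a power. -/
lemma fourier_indicator_pow_mul_cexp (n : ℕ) {a : ℝ} (ha : 0 < a) (w : ℝ) :
    𝓕 ((Ioi (0 : ℝ)).indicator fun t : ℝ =>
      (t : ℂ) ^ n * Complex.exp (-(2 * Real.pi * a * t))) w =
      n.factorial / (2 * Real.pi * (a + Complex.I * w)) ^ (n + 1) := by
  have hc : 0 < (2 * Real.pi * (a + Complex.I * w)).re := by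
    simp
    positivity
  rw [Real.fourier_real_eq_integral_exp_smul, ← integral_Ioi_pow_mul_cexp_neg_mul n hc,
    ← integral_indicator measurableSet_Ioi]
  congr 1 with t
  by_cases ht : t ∈ Ioi (0 : ℝ)
  · simp only [indicator_of_mem ht, smul_eq_mul]
    rw [mul_left_comm, ← Complex.exp_add]
    congr 2
    push_cast
    ring
  · simp [indicator_of_notMem ht]

lemma integrable_inv_add_I_mul_pow {m : ℕ} (hm : 2 ≤ m) {a : ℝ} (ha : 1 ≤ a) :
    Integrable fun w : ℝ => (((a : ℂ) + Complex.I * w) ^ m)⁻¹ := by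
  have hne (w : ℝ) : (a : ℂ) + Complex.I * w ≠ 0 := fun h => by
    have := congrArg Complex.re h
    simp at this
    linarith
  refine integrable_inv_one_add_sq.mono' ?_ (Eventually.of_forall fun w => ?_)
  · exact (Continuous.inv₀ (by fun_prop) fun w => pow_ne_zero _ (hne w)).aestronglyMeasurable
  · have hsq : ‖(a : ℂ) + Complex.I * w‖ ^ 2 = a ^ 2 + w ^ 2 := by
      rw [Complex.sq_norm, Complex.normSq_apply]
      simp
      ring
    have h1 : 1 ≤ ‖(a : ℂ) + Complex.I * w‖ := by
      nlinarith [norm_nonneg ((a : ℂ) + Complex.I * w), sq_nonneg w]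
    rw [norm_inv, norm_pow]
    refine inv_anti₀ (by positivity) (le_trans ?_ (pow_le_pow_right₀ h1 hm))
    nlinarith

lemma continuous_indicator_Ioi_pow_mul_cexp {n : ℕ} (hn : n ≠ 0) (c : ℂ) :
    Continuous ((Ioi (0 : ℝ)).indicator fun t : ℝ => (t : ℂ) ^ n * Complex.exp (-(c * t))) := by
  refine continuous_indicator (fun t ht => ?_) (by fun_prop)
  rw [frontier_Ioi, mem_singleton_iff] at ht
  simp [ht, hn]

/-- Lemma 4.2 of the paper. For `k` an even positive integer, `x : ℝ`, `y > 0`,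
the integral `∫ℝ e^{2πixu} (−u + i(y+1))^{−k} du` equals
`((2πi)^k / Γ(k)) · x^{k−1} e^{−2πx(y+1)}` if `x ≥ 0`, and `0` otherwise. -/
theorem stmt_0 (k : ℕ) (hk : Even k) (hkpos : 0 < k) (x y : ℝ) (hy : 0 < y) :
    (∫ u : ℝ, Complex.exp (2 * Real.pi * Complex.I * x * u) *
        (-(u : ℂ) + Complex.I * ((y : ℂ) + 1)) ^ (-(k : ℤ))) =
      if 0 ≤ x then
        (2 * Real.pi * Complex.I) ^ k / Complex.Gamma (k : ℂ) *
          (x : ℂ) ^ (k - 1) * Complex.exp (-(2 * Real.pi * x * (y + 1)))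
      else 0 := by
  obtain ⟨n, rfl⟩ : ∃ n, k = n + 1 := ⟨k - 1, by omega⟩
  have hn : n ≠ 0 := by
    rintro rfl
    simp at hk
  have ha : 0 < y + 1 := by linarith
  set f : ℝ → ℂ := (Ioi (0 : ℝ)).indicator fun t : ℝ =>
    (t : ℂ) ^ n * Complex.exp (-(2 * Real.pi * (y + 1 : ℝ) * t)) with hf
  have hfour (w : ℝ) := fourier_indicator_pow_mul_cexp n ha w
  have hcont : Continuous f := continuous_indicator_Ioi_pow_mul_cexp hn _
  have hint : Integrable f := by
    refine (integrable_indicator_iff measurableSet_Ioi).mpr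
      (integrableOn_Ioi_pow_mul_cexp_neg_mul n ?_)
    simp
    positivity
  have hint' : Integrable (𝓕 f) := by
    refine ((integrable_inv_add_I_mul_pow (m := n + 1) (by omega)
      (show 1 ≤ y + 1 by linarith)).const_mul
        (n.factorial / (2 * Real.pi : ℂ) ^ (n + 1))).congr (Eventually.of_forall fun w => ?_)
    rw [hf, hfour, mul_pow _ (_ + _), ← div_div, div_eq_mul_inv (_ / _)]
  have hinv := congrFun (hcont.fourierInv_fourier_eq hint hint') x
  rw [Real.fourierInv_eq'] at hinv
  have hfac : (n.factorial : ℂ) ≠ 0 := Nat.cast_ne_zero.mpr n.factorial_ne_zero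
  have hpi : (Real.pi : ℂ) ≠ 0 := Complex.ofReal_ne_zero.mpr Real.pi_ne_zero
  have hI : (Complex.I ^ (n + 1))⁻¹ = Complex.I ^ (n + 1) := by
    rw [← inv_pow, Complex.inv_I, hk.neg_pow]
  have key (u : ℝ) : Complex.exp (2 * Real.pi * Complex.I * x * u) *
        (-(u : ℂ) + Complex.I * ((y : ℂ) + 1)) ^ (-((n + 1 : ℕ) : ℤ)) =
      (2 * Real.pi * Complex.I) ^ (n + 1) / n.factorial *
        (Complex.exp (↑(2 * Real.pi * inner ℝ u x) * Complex.I) • 𝓕 f u) := by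
    have h1 : -(u : ℂ) + Complex.I * ((y : ℂ) + 1) =
        Complex.I * (((y + 1 : ℝ) : ℂ) + Complex.I * u) := by
      push_cast
      linear_combination (-(u : ℂ)) * Complex.I_mul_I
    have h2 : (2 * Real.pi * Complex.I * x * u : ℂ) =
        ↑(2 * Real.pi * inner ℝ u x) * Complex.I := by
      simp
      ring
    rw [h1, h2, hf, hfour, zpow_neg, zpow_natCast, mul_pow Complex.I, mul_inv, hI, smul_eq_mul,
      mul_pow _ Complex.I, mul_pow _ (_ + _)]
    field_simp
  simp_rw [key]
  rw [integral_const_mul, hinv, Nat.cast_succ, Complex.Gamma_nat_eq_factorial, Nat.add_sub_cancel]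
  split_ifs with hx
  · rcases hx.eq_or_lt with rfl | hx
    · simp [hf, hn]
    · rw [hf, indicator_of_mem (mem_Ioi.mpr hx), ← mul_assoc]
      congr 2
      push_cast
      ring
  · rw [hf, indicator_of_notMem (by simpa using (not_le.mp hx).le), mul_zero]
end

section
/- Let k be an even integer with k ≥ 4, and let s₁, s₂ ∈ ℂ satisfy 0 < Re(s₁ + s₂) < k, Re(s₁) < k/2 and Re(s₂) < k/2. Then the iterated integral ∫_0^∞ y^{k/2 − s₁ − 1} ( ∫_0^∞ x^{s₁+s₂−1} (x + i(y+1))^{−k} dx ) dy converges and equals e^{iπ(s₁+s₂)/2} · i^{−k} · B(s₁+s₂, k−s₁−s₂) · B(k/2 − s₁, k/2 − s₂). -/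
open MeasureTheory Set

/-- The Beta function `B(a,b) = Γ(a)Γ(b)/Γ(a+b)`. -/
noncomputable def cBeta (a b : ℂ) : ℂ :=
  Complex.Gamma a * Complex.Gamma b / Complex.Gamma (a + b)

lemma integrableOn_cpow_mul_exp_neg_mul_Ioi {a : ℂ} {r : ℝ} (ha : 0 < a.re) (hr : 0 < r) :
    IntegrableOn (fun t : ℝ => (t : ℂ) ^ (a - 1) * Complex.exp (-(r * t))) (Ioi 0) := by
  have hreal := integrableOn_rpow_mul_exp_neg_mul_rpow (p := 1) (s := a.re - 1) (b := r)
    (by linarith) one_pos hr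
  refine Integrable.mono' hreal (by fun_prop) ?_
  filter_upwards [ae_restrict_mem measurableSet_Ioi] with t ht
  rw [norm_mul, Complex.norm_cpow_eq_rpow_re_of_pos ht, Complex.norm_exp]
  simp

lemma integrable_gammaKernel {a b : ℂ} {r : ℝ} (ha : 0 < a.re) (hb : 0 < b.re) (hr : 0 < r) :
    Integrable (Function.uncurry fun t u : ℝ =>
        (t : ℂ) ^ (a - 1) * ((u : ℂ) ^ (a + b - 1) * Complex.exp (-((t + r : ℝ) * u))))
      ((volume.restrict (Ioi 0)).prod (volume.restrict (Ioi 0))) := by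
  rw [integrable_prod_iff' (by unfold Function.uncurry; fun_prop)]
  constructor
  · filter_upwards [ae_restrict_mem measurableSet_Ioi] with u hu
    refine ((integrableOn_cpow_mul_exp_neg_mul_Ioi ha hu).const_mul
      ((u : ℂ) ^ (a + b - 1) * Complex.exp (-(r * u)))).congr (.of_forall fun t => ?_)
    simp only [Function.uncurry]
    rw [show -(((t + r : ℝ) : ℂ) * u) = -(r * u) + -(u * t) by push_cast; ring, Complex.exp_add]
    ring
  · have hreal := (integrableOn_rpow_mul_exp_neg_mul_rpow (p := 1) (s := b.re - 1) (b := r)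
      (by linarith) one_pos hr).mul_const (Real.Gamma a.re)
    refine hreal.congr ?_
    filter_upwards [ae_restrict_mem measurableSet_Ioi] with u hu
    have hu' : 0 < u := hu
    have key := Real.integral_rpow_mul_exp_neg_mul_Ioi ha hu'
    calc u ^ (b.re - 1) * Real.exp (-r * u ^ (1 : ℝ)) * Real.Gamma a.re
        = u ^ (a.re + b.re - 1) * Real.exp (-(r * u)) *
            ((1 / u) ^ a.re * Real.Gamma a.re) := by
          rw [show a.re + b.re - 1 = (b.re - 1) + a.re by ring, Real.rpow_add hu',
            one_div, Real.inv_rpow hu'.le, Real.rpow_one]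
          have : u ^ a.re ≠ 0 := (Real.rpow_pos_of_pos hu' _).ne'
          field_simp
      _ = _ := by
          rw [← key, ← integral_const_mul]
          refine setIntegral_congr_fun measurableSet_Ioi fun t ht => ?_
          simp only [Function.uncurry]
          rw [norm_mul, norm_mul, Complex.norm_cpow_eq_rpow_re_of_pos ht,
            Complex.norm_cpow_eq_rpow_re_of_pos hu, Complex.norm_exp,
            show (-(((t + r : ℝ) : ℂ) * u)).re = -(r * u) + -(u * t) by
              rw [← Complex.ofReal_mul, ← Complex.ofReal_neg, Complex.ofReal_re]; ring,
            Real.exp_add]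
          simp only [Complex.sub_re, Complex.add_re, Complex.one_re]
          ring

lemma integrableOn_and_integral_cpow_mul_add_cpow_Ioi {a b : ℂ} {r : ℝ}
    (ha : 0 < a.re) (hb : 0 < b.re) (hr : 0 < r) :
    IntegrableOn (fun t : ℝ => (t : ℂ) ^ (a - 1) * ((t : ℂ) + r) ^ (-(a + b))) (Ioi 0) ∧
    ∫ t in Ioi (0 : ℝ), (t : ℂ) ^ (a - 1) * ((t : ℂ) + r) ^ (-(a + b)) =
      cBeta a b * (r : ℂ) ^ (-b) := by
  have hab : 0 < (a + b).re := by simpa using add_pos ha hb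
  have hG : Complex.Gamma (a + b) ≠ 0 := Complex.Gamma_ne_zero_of_re_pos hab
  have hI := integrable_gammaKernel ha hb hr
  have hinv (x : ℝ) (hx : 0 < x) (c : ℂ) : (1 / (x : ℂ)) ^ c = (x : ℂ) ^ (-c) := by
    rw [one_div, Complex.inv_cpow _ _ (by
      rw [Complex.arg_ofReal_of_nonneg hx.le]; exact Real.pi_pos.ne), Complex.cpow_neg]
  have hleft : ∀ t ∈ Ioi (0 : ℝ), ∫ u in Ioi (0 : ℝ),
      (t : ℂ) ^ (a - 1) * ((u : ℂ) ^ (a + b - 1) * Complex.exp (-((t + r : ℝ) * u))) =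
      (t : ℂ) ^ (a - 1) * ((t : ℂ) + r) ^ (-(a + b)) * Complex.Gamma (a + b) := by
    intro t ht
    have htr : 0 < t + r := add_pos ht hr
    rw [integral_const_mul, Complex.integral_cpow_mul_exp_neg_mul_Ioi hab htr, hinv _ htr]
    push_cast; ring
  have hright : ∀ u ∈ Ioi (0 : ℝ), ∫ t in Ioi (0 : ℝ),
      (t : ℂ) ^ (a - 1) * ((u : ℂ) ^ (a + b - 1) * Complex.exp (-((t + r : ℝ) * u))) =
      Complex.Gamma a * ((u : ℂ) ^ (b - 1) * Complex.exp (-(r * u))) := by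
    intro u hu
    have hu' : 0 < u := hu
    have hu0 : (u : ℂ) ≠ 0 := by exact_mod_cast hu'.ne'
    have : ∀ t : ℝ,
        (t : ℂ) ^ (a - 1) * ((u : ℂ) ^ (a + b - 1) * Complex.exp (-((t + r : ℝ) * u))) =
        (u : ℂ) ^ (a + b - 1) * Complex.exp (-(r * u)) *
          ((t : ℂ) ^ (a - 1) * Complex.exp (-(u * t))) := by
      intro t
      rw [show -(((t + r : ℝ) : ℂ) * u) = -(r * u) + -(u * t) by push_cast; ring,
        Complex.exp_add]
      ring
    simp_rw [this]
    rw [integral_const_mul, Complex.integral_cpow_mul_exp_neg_mul_Ioi ha hu', hinv _ hu',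
      show b - 1 = (a + b - 1) + -a by ring, Complex.cpow_add _ _ hu0]
    ring
  constructor
  · have h := hI.integral_prod_left
    simp only [Function.uncurry] at h
    have h2 := (integrableOn_congr_fun hleft measurableSet_Ioi).1 h
    refine (h2.mul_const (Complex.Gamma (a + b))⁻¹).congr (.of_forall fun t => ?_)
    simp only
    rw [mul_assoc, mul_inv_cancel₀ hG, mul_one]
  · have h := integral_integral_swap hI
    rw [setIntegral_congr_fun measurableSet_Ioi hleft,
      setIntegral_congr_fun measurableSet_Ioi hright, integral_mul_const, integral_const_mul,
      Complex.integral_cpow_mul_exp_neg_mul_Ioi hb hr, hinv _ hr] at h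
    rw [cBeta]
    field_simp
    rw [h]; ring

lemma half_add_re_add_im_le_norm (t : ℝ) (w : ℂ) : (t + (w.re + w.im)) / 2 ≤ ‖(t : ℂ) + w‖ := by
  have h1 := Complex.re_le_norm ((t : ℂ) + w)
  have h2 := (le_abs_self _).trans (Complex.abs_im_le_norm ((t : ℂ) + w))
  simp only [Complex.add_re, Complex.add_im, Complex.ofReal_re, Complex.ofReal_im] at h1 h2
  linarith

lemma norm_inv_add_pow_le {t δ : ℝ} (ht : 0 < t) (hδ : 0 < δ) {w : ℂ} (hw : δ ≤ w.re + w.im)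
    (n : ℕ) : ‖(((t : ℂ) + w) ^ n)⁻¹‖ ≤ 2 ^ n * ((t + δ) ^ n)⁻¹ := by
  have h := half_add_re_add_im_le_norm t w
  rw [norm_inv, norm_pow, ← div_eq_mul_inv, ← div_pow, ← inv_pow]
  refine pow_le_pow_left₀ (by positivity) ?_ n
  rw [← inv_div]
  exact inv_anti₀ (by positivity) (by linarith)

lemma integrableOn_rpow_mul_inv_add_pow_Ioi {σ δ : ℝ} {n : ℕ} (hσ : 0 < σ) (hσn : σ < n)
    (hδ : 0 < δ) : IntegrableOn (fun t : ℝ => t ^ (σ - 1) * ((t + δ) ^ n)⁻¹) (Ioi 0) := by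
  have h := (integrableOn_and_integral_cpow_mul_add_cpow_Ioi (a := σ) (b := n - σ) (r := δ)
    (by simpa) (by simpa) hδ).1.norm
  refine (integrableOn_congr_fun (fun t ht => ?_) measurableSet_Ioi).1 h
  have htδ : 0 < t + δ := add_pos ht hδ
  rw [norm_mul, Complex.norm_cpow_eq_rpow_re_of_pos ht, ← Complex.ofReal_add,
    Complex.norm_cpow_eq_rpow_re_of_pos htδ]
  simp [Real.rpow_neg htδ.le]

lemma norm_cpow_mul_inv_add_pow_le {s : ℂ} {t δ : ℝ} (ht : 0 < t) (hδ : 0 < δ) {w : ℂ}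
    (hw : δ ≤ w.re + w.im) (n : ℕ) :
    ‖(t : ℂ) ^ (s - 1) * (((t : ℂ) + w) ^ n)⁻¹‖ ≤
      2 ^ n * (t ^ (s.re - 1) * ((t + δ) ^ n)⁻¹) := by
  rw [norm_mul, Complex.norm_cpow_eq_rpow_re_of_pos ht, Complex.sub_re, Complex.one_re,
    mul_left_comm]
  exact mul_le_mul_of_nonneg_left (norm_inv_add_pow_le ht hδ hw n) (by positivity)

lemma integrableOn_cpow_mul_inv_add_pow_Ioi {s w : ℂ} {n : ℕ} (hs : 0 < s.re) (hsn : s.re < n)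
    (hw : 0 < w.re + w.im) :
    IntegrableOn (fun t : ℝ => (t : ℂ) ^ (s - 1) * (((t : ℂ) + w) ^ n)⁻¹) (Ioi 0) := by
  refine Integrable.mono' ((integrableOn_rpow_mul_inv_add_pow_Ioi hs hsn hw).const_mul (2 ^ n))
    (by fun_prop) ?_
  filter_upwards [ae_restrict_mem measurableSet_Ioi] with t ht
  exact norm_cpow_mul_inv_add_pow_le ht hw le_rfl n

lemma isOpen_lt_re_add_im (δ : ℝ) : IsOpen {w : ℂ | δ < w.re + w.im} :=
  isOpen_lt continuous_const (Complex.continuous_re.add Complex.continuous_im)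

lemma differentiableOn_integral_cpow_mul_inv_add_pow_Ioi {s : ℂ} {n : ℕ} (hs : 0 < s.re)
    (hsn : s.re < n) :
    DifferentiableOn ℂ
      (fun w : ℂ => ∫ t in Ioi (0 : ℝ), (t : ℂ) ^ (s - 1) * (((t : ℂ) + w) ^ n)⁻¹)
      {w | 0 < w.re + w.im} := by
  intro w₀ hw₀
  set δ := (w₀.re + w₀.im) / 2
  have hδ : 0 < δ := half_pos hw₀
  have hmem : {w : ℂ | δ < w.re + w.im} ∈ nhds w₀ :=
    (isOpen_lt_re_add_im δ).mem_nhds (show δ < _ from half_lt_self hw₀)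
  refine (hasDerivAt_integral_of_dominated_loc_of_deriv_le hmem
    (μ := volume.restrict (Ioi 0))
    (F := fun w t => (t : ℂ) ^ (s - 1) * (((t : ℂ) + w) ^ n)⁻¹)
    (F' := fun w t => -n * ((t : ℂ) ^ (s - 1) * (((t : ℂ) + w) ^ (n + 1))⁻¹))
    (bound := fun t => n * (2 ^ (n + 1) * (t ^ (s.re - 1) * ((t + δ) ^ (n + 1))⁻¹)))
    (.of_forall fun w => by fun_prop)
    (integrableOn_cpow_mul_inv_add_pow_Ioi hs hsn hw₀) (by fun_prop) ?_ ?_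
    ?_).2.differentiableAt.differentiableWithinAt
  · filter_upwards [ae_restrict_mem measurableSet_Ioi] with t ht w hw
    rw [norm_mul, norm_neg, Complex.norm_natCast]
    exact mul_le_mul_of_nonneg_left (norm_cpow_mul_inv_add_pow_le ht hδ (le_of_lt hw) _)
      n.cast_nonneg
  · exact ((integrableOn_rpow_mul_inv_add_pow_Ioi hs (by push_cast; linarith) hδ).const_mul
      _).const_mul _
  · filter_upwards [ae_restrict_mem measurableSet_Ioi] with t ht w hw
    have ht' : 0 < t := ht
    have hw' : δ < w.re + w.im := hw
    have h0 : (t : ℂ) + w ≠ 0 :=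
      norm_pos_iff.1 (lt_of_lt_of_le (by linarith) (half_add_re_add_im_le_norm t w))
    have hd : HasDerivAt (fun w : ℂ => ((t : ℂ) + w) ^ n) (n * ((t : ℂ) + w) ^ (n - 1)) w := by
      simpa using ((hasDerivAt_id w).const_add (t : ℂ)).fun_pow n
    refine ((hd.fun_inv (pow_ne_zero n h0)).const_mul ((t : ℂ) ^ (s - 1))).congr_deriv ?_
    rcases n with _ | m
    · simp
    · simp only [Nat.add_sub_cancel]
      field_simp
      ring

/-- The Mellin transform of `t ↦ (t + w) ^ (-n)`, continued analytically from `w > 0` to the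
half-plane `0 < re w + im w`. -/
lemma integral_cpow_mul_inv_add_pow_Ioi {s w : ℂ} {n : ℕ} (hs : 0 < s.re) (hsn : s.re < n)
    (hw : 0 < w.re + w.im) :
    ∫ t in Ioi (0 : ℝ), (t : ℂ) ^ (s - 1) * (((t : ℂ) + w) ^ n)⁻¹ =
      cBeta s (n - s) * w ^ (-(n - s)) := by
  have hopen := isOpen_lt_re_add_im 0
  have hpre : IsPreconnected {w : ℂ | 0 < w.re + w.im} :=
    (convex_halfSpace_gt (Complex.reLm + Complex.imLm).isLinear 0).isPreconnected
  have hslit : ∀ w : ℂ, 0 < w.re + w.im → w ∈ Complex.slitPlane := by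
    intro w hw
    rw [Complex.mem_slitPlane_iff]
    by_contra! h
    linarith
  have hF := (differentiableOn_integral_cpow_mul_inv_add_pow_Ioi hs hsn).analyticOnNhd hopen
  have hG : AnalyticOnNhd ℂ (fun w : ℂ => cBeta s (n - s) * w ^ (-(n - s)))
      {w | 0 < w.re + w.im} := by
    refine DifferentiableOn.analyticOnNhd (fun w hw => ?_) hopen
    exact ((differentiableAt_id.cpow_const (hslit w hw)).const_mul _).differentiableWithinAt
  have hreal : ∀ r : ℝ, 0 < r →
      ∫ t in Ioi (0 : ℝ), (t : ℂ) ^ (s - 1) * (((t : ℂ) + r) ^ n)⁻¹ =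
        cBeta s (n - s) * (r : ℂ) ^ (-(n - s)) := by
    intro r hr
    rw [← (integrableOn_and_integral_cpow_mul_add_cpow_Ioi hs
      (by simpa using hsn : 0 < ((n : ℂ) - s).re) hr).2]
    simp [Complex.cpow_neg]
  have htends : Filter.Tendsto (fun r : ℝ => (r : ℂ)) (nhdsWithin 1 {1}ᶜ)
      (nhdsWithin 1 {1}ᶜ) := by
    refine tendsto_nhdsWithin_iff.2 ⟨?_, ?_⟩
    · exact (Complex.continuous_ofReal.tendsto' 1 1 (by simp)).mono_left nhdsWithin_le_nhds
    · filter_upwards [self_mem_nhdsWithin] with r hr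
      simpa using hr
  refine hF.eqOn_of_preconnected_of_frequently_eq hG hpre (z₀ := 1) (by simp) ?_ hw
  refine htends.frequently (Filter.Eventually.frequently ?_)
  filter_upwards [nhdsWithin_le_nhds (Ioi_mem_nhds (zero_lt_one' ℝ))] with r hr
  exact hreal r hr

/-- the archimedean dual orbital integral `J⁺` of Lemma 5.2 of the paper.
For `k` even, `k ≥ 4`, `0 < Re(s₁+s₂) < k`, `Re s₁ < k/2`, `Re s₂ < k/2`, the iterated integral
`∫₀^∞ y^{k/2−s₁−1} (∫₀^∞ x^{s₁+s₂−1}(x+i(y+1))^{−k} dx) dy` converges and equals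
`e^{iπ(s₁+s₂)/2} i^{−k} B(s₁+s₂, k−s₁−s₂) B(k/2−s₁, k/2−s₂)`. -/
theorem stmt_2 (k : ℕ) (hk : Even k) (hk4 : 4 ≤ k) (s₁ s₂ : ℂ)
    (h0 : 0 < (s₁ + s₂).re) (hk' : (s₁ + s₂).re < k)
    (h1 : s₁.re < (k : ℝ) / 2) (h2 : s₂.re < (k : ℝ) / 2) :
    (∀ y ∈ Ioi (0 : ℝ), IntegrableOn (fun x : ℝ =>
        (x : ℂ) ^ (s₁ + s₂ - 1) * ((x : ℂ) + Complex.I * ((y : ℂ) + 1)) ^ (-(k : ℤ)))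
        (Ioi 0)) ∧
    IntegrableOn (fun y : ℝ => (y : ℂ) ^ ((k : ℂ) / 2 - s₁ - 1) *
        ∫ x in Ioi (0 : ℝ),
          (x : ℂ) ^ (s₁ + s₂ - 1) * ((x : ℂ) + Complex.I * ((y : ℂ) + 1)) ^ (-(k : ℤ)))
        (Ioi 0) ∧
    (∫ y in Ioi (0 : ℝ), (y : ℂ) ^ ((k : ℂ) / 2 - s₁ - 1) *
        ∫ x in Ioi (0 : ℝ),
          (x : ℂ) ^ (s₁ + s₂ - 1) * ((x : ℂ) + Complex.I * ((y : ℂ) + 1)) ^ (-(k : ℤ))) =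
      Complex.exp (Complex.I * Real.pi * (s₁ + s₂) / 2) * Complex.I ^ (-(k : ℤ)) *
        cBeta (s₁ + s₂) ((k : ℂ) - (s₁ + s₂)) *
        cBeta ((k : ℂ) / 2 - s₁) ((k : ℂ) / 2 - s₂) := by
  set s := s₁ + s₂ with hs_def
  have hzpow : ∀ x y : ℝ, ((x : ℂ) + Complex.I * ((y : ℂ) + 1)) ^ (-(k : ℤ)) =
      (((x : ℂ) + Complex.I * ((y : ℂ) + 1)) ^ k)⁻¹ := fun x y => by
    rw [zpow_neg, zpow_natCast]
  simp_rw [hzpow]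
  have hw : ∀ y ∈ Ioi (0 : ℝ),
      0 < (Complex.I * ((y : ℂ) + 1)).re + (Complex.I * ((y : ℂ) + 1)).im := by
    intro y hy
    have : 0 < y := hy
    simp only [Complex.I_mul_re, Complex.I_mul_im, Complex.add_re, Complex.add_im,
      Complex.ofReal_re, Complex.ofReal_im, Complex.one_re, Complex.one_im]
    linarith
  set C := Complex.exp (Complex.I * Real.pi * s / 2) * Complex.I ^ (-(k : ℤ)) *
    cBeta s ((k : ℂ) - s) with hC
  have hinner : EqOn (fun y : ℝ => C * ((y : ℂ) ^ ((k : ℂ) / 2 - s₁ - 1) * ((y : ℂ) + (1 : ℝ)) ^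
        (-((k / 2 - s₁) + (k / 2 - s₂)))))
      (fun y : ℝ => (y : ℂ) ^ ((k : ℂ) / 2 - s₁ - 1) * ∫ x in Ioi (0 : ℝ),
        (x : ℂ) ^ (s - 1) * (((x : ℂ) + Complex.I * ((y : ℂ) + 1)) ^ k)⁻¹) (Ioi 0) := by
    intro y hy
    have hy1 : 0 < y + 1 := add_pos hy one_pos
    have hy0 : (y : ℂ) + 1 ≠ 0 := by exact_mod_cast hy1.ne'
    have hrot : (Complex.I * ((y : ℂ) + 1)) ^ (-(k - s)) =
        Complex.exp (Complex.I * Real.pi * s / 2) * Complex.I ^ (-(k : ℤ)) *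
          ((y : ℂ) + 1) ^ (-(k - s)) := by
      have hlog : Complex.log (Complex.I * ((y : ℂ) + 1)) =
          Complex.log ((y : ℂ) + 1) + Complex.log Complex.I := by
        have := Complex.log_mul_ofReal (y + 1) hy1 Complex.I Complex.I_ne_zero
        rw [Complex.ofReal_log hy1.le] at this
        simpa using this
      rw [← Complex.cpow_intCast, Complex.cpow_def_of_ne_zero Complex.I_ne_zero,
        Complex.cpow_def_of_ne_zero (mul_ne_zero Complex.I_ne_zero hy0),
        Complex.cpow_def_of_ne_zero hy0, hlog, Complex.log_I, ← Complex.exp_add,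
        ← Complex.exp_add]
      congr 1
      push_cast
      ring
    simp only
    rw [integral_cpow_mul_inv_add_pow_Ioi h0 hk' (hw y hy), hrot, hC, hs_def,
      show -(((k : ℂ) / 2 - s₁) + (k / 2 - s₂)) = -(k - (s₁ + s₂)) by ring, Complex.ofReal_one]
    ring
  have ha : 0 < ((k : ℂ) / 2 - s₁).re := by
    simpa [show ((k : ℂ) / 2).re = (k : ℝ) / 2 by simp] using h1
  have hb : 0 < ((k : ℂ) / 2 - s₂).re := by
    simpa [show ((k : ℂ) / 2).re = (k : ℝ) / 2 by simp] using h2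
  obtain ⟨hint, hval⟩ := integrableOn_and_integral_cpow_mul_add_cpow_Ioi ha hb one_pos
  refine ⟨fun y hy => integrableOn_cpow_mul_inv_add_pow_Ioi h0 hk' (hw y hy),
    (integrableOn_congr_fun hinner measurableSet_Ioi).1 (hint.const_mul C), ?_⟩
  rw [← setIntegral_congr_fun measurableSet_Ioi hinner, integral_const_mul, hval]
  simp
end

section
/- Let R, c₀ ∈ ℂ and let N > 0 be real. Let Z be a complex-valued function defined on a punctured neighborhood of 0 in ℂ such that Z(s) − R/s → c₀ as s → 0, and let H be a complex-valued function defined on a neighborhood of 0 that is complex differentiable at 0. Then, as s → 0 with s ≠ 0, H(s)·Z(s) + N^{−s}·H(−s)·Z(−s) converges to 2·H(0)·c₀ + 2·R·H′(0) + R·H(0)·log N, where N^{−s} = exp(−s log N). -/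
open Filter Topology

/-- the analytic content of Lemma 6.2 of the paper.
If `Z(s) − R/s → c₀` as `s → 0` and `H` is complex differentiable at `0` with derivative `H'`,
then as `s → 0` with `s ≠ 0`, `H(s)Z(s) + N^{−s} H(−s) Z(−s)` tends to
`2 H(0) c₀ + 2 R H'(0) + R H(0) log N`. -/
theorem stmt_4 (R c₀ : ℂ) (N : ℝ) (hN : 0 < N) (Z H : ℂ → ℂ) (H' : ℂ)
    (hZ : Tendsto (fun s : ℂ => Z s - R / s) (𝓝[≠] 0) (𝓝 c₀))
    (hH : HasDerivAt H H' 0) :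
    Tendsto (fun s : ℂ => H s * Z s + (N : ℂ) ^ (-s) * H (-s) * Z (-s))
      (𝓝[≠] 0)
      (𝓝 (2 * H 0 * c₀ + 2 * R * H' + R * H 0 * Real.log N)) := by
  have hN0 : (N : ℂ) ≠ 0 := by exact_mod_cast hN.ne'
  have hneg : Tendsto (fun s : ℂ => -s) (𝓝[≠] 0) (𝓝[≠] 0) := by
    refine tendsto_nhdsWithin_iff.2 ⟨?_, ?_⟩
    · simpa using (continuous_neg.tendsto (0 : ℂ)).mono_left nhdsWithin_le_nhds
    · filter_upwards [self_mem_nhdsWithin] with s hs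
      simpa using hs
  have hE : HasDerivAt (fun s : ℂ => (N : ℂ) ^ (-s)) (-Real.log N : ℂ) 0 := by
    have h := (hasDerivAt_neg (0 : ℂ)).const_cpow (c := (N : ℂ)) (Or.inl hN0)
    simpa [Complex.ofReal_log hN.le] using h
  have hHneg : HasDerivAt (fun s : ℂ => H (-s)) (-H') 0 := by
    have h : HasDerivAt H H' (-0) := by simpa using hH
    simpa [Function.comp_def] using h.comp (0 : ℂ) (hasDerivAt_neg (0 : ℂ))
  have hEH := hE.mul hHneg
  have hslope := hasDerivAt_iff_tendsto_slope_zero.1 (hH.sub hEH)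
  have hH0 : Tendsto H (𝓝[≠] 0) (𝓝 (H 0)) :=
    hH.continuousAt.tendsto.mono_left nhdsWithin_le_nhds
  have hEH0 := hEH.continuousAt.tendsto.mono_left (nhdsWithin_le_nhds (s := {0}ᶜ))
  have hlim := ((hH0.mul hZ).add (hEH0.mul (hZ.comp hneg))).add (hslope.const_mul R)
  refine (hlim.congr' ?_).trans_eq ?_
  · filter_upwards [self_mem_nhdsWithin] with s hs
    have hs0 : s ≠ 0 := hs
    simp only [Function.comp_apply, Pi.sub_apply, Pi.mul_apply, smul_eq_mul, zero_add, neg_zero,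
      Complex.cpow_zero, one_mul, sub_self, sub_zero]
    field_simp
    ring
  · simp only [Pi.mul_apply, neg_zero, Complex.cpow_zero, one_mul]
    congr 1
    ring
end

section
/- Let k be an even integer with k ≥ 4 and let t > 0 be a real number with t ≠ 1. Then the double integral over (ℝ∖{0}) × (ℝ∖{0}), with respect to the measure (dy/|y|)(dx/|x|), of the function (x,y) ↦ (y(1−t))^{k/2} · 1_{y(1−t)>0} · (−x^{−1} t + x y + i(y+1))^{−k} converges absolutely and equals 2^{2−k/2} · i^{−k} · B(k/2, k/2) · ∫_{−1}^{1} (1−u²)^{k/2−1} ( (1+t)/(1−t) − u )^{−k/2} du. -/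
open MeasureTheory

open Set Filter Topology Bornology

theorem tendsto_inv_mul_ofReal_add_cobounded {a : ℂ} (ha : a ≠ 0) (b : ℂ) :
    Tendsto (fun v : ℝ => (a * v + b)⁻¹) (cobounded ℝ) (𝓝 0) := by
  refine tendsto_inv₀_cobounded.comp (tendsto_norm_atTop_iff_cobounded.1 ?_)
  have h : Tendsto (fun v : ℝ => ‖a‖ * ‖v‖ + -‖b‖) (cobounded ℝ) atTop :=
    tendsto_atTop_add_const_right _ _
      (tendsto_norm_cobounded_atTop.const_mul_atTop (norm_pos_iff.2 ha))
  refine tendsto_atTop_mono (fun v => ?_) h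
  have := norm_sub_norm_le (a * v) (-b)
  rw [norm_neg, sub_neg_eq_add, norm_mul, Complex.norm_real] at this
  linarith

theorem integral_Ioi_pow_div_pow (n : ℕ) {a b : ℂ} (ha : a ≠ 0) (hb : b ≠ 0)
    (h : ∀ v : ℝ, 0 ≤ v → a * v + b ≠ 0)
    (hint : IntegrableOn (fun v : ℝ => (v : ℂ) ^ n / (a * v + b) ^ (2 * (n + 1))) (Ioi 0)) :
    ∫ v in Ioi (0 : ℝ), (v : ℂ) ^ n / (a * v + b) ^ (2 * (n + 1)) =
      (∫ s in (0 : ℝ)..1, (s : ℂ) ^ n * (1 - s) ^ n) / (a * b) ^ (n + 1) := by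
  obtain ⟨Q, hQ⟩ := (show Differentiable ℂ fun z : ℂ => z ^ n * (1 - z) ^ n by
    fun_prop).isExactOn_univ
  replace hQ (z : ℂ) : HasDerivAt Q (z ^ n * (1 - z) ^ n) z := hQ z (mem_univ z)
  have hbeta : ∫ s in (0 : ℝ)..1, (s : ℂ) ^ n * (1 - s) ^ n = Q 1 - Q 0 := by
    rw [intervalIntegral.integral_eq_sub_of_hasDerivAt (fun s _ => (hQ s).comp_ofReal)
      (Continuous.intervalIntegrable (by fun_prop) _ _)]
    simp
  have hderiv (v : ℝ) (hv : v ∈ Ici (0 : ℝ)) :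
      HasDerivAt (fun v : ℝ => Q (1 - b * (a * v + b)⁻¹) / (a * b) ^ (n + 1))
        ((v : ℂ) ^ n / (a * v + b) ^ (2 * (n + 1))) v := by
    have h0 := h v hv
    have hlin : HasDerivAt (fun v : ℝ => a * (v : ℂ) + b) a v := by
      simpa using ((hasDerivAt_id (v : ℂ)).comp_ofReal.const_mul a).add_const b
    have hw := ((hlin.inv h0).const_mul b).const_sub 1
    refine (((hQ _).comp v hw).div_const ((a * b) ^ (n + 1))).congr_deriv ?_
    have h1 : (1 - b * (a * (v : ℂ) + b)⁻¹) = a * v / (a * v + b) := by field_simp; ring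
    have h2 : 1 - a * v / (a * v + b) = b / (a * v + b) := by field_simp; ring
    simp only [Pi.inv_apply]
    rw [h1, h2]
    simp only [div_pow, mul_pow]
    field_simp
    ring
  have hlim : Tendsto (fun v : ℝ => Q (1 - b * (a * v + b)⁻¹) / (a * b) ^ (n + 1)) atTop
      (𝓝 (Q 1 / (a * b) ^ (n + 1))) := by
    refine Tendsto.div_const ((hQ 1).continuousAt.tendsto.comp ?_) _
    simpa using (((tendsto_inv_mul_ofReal_add_cobounded ha b).mono_left
      IsOrderBornology.atTop_le_cobounded).const_mul b).const_sub 1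
  rw [integral_Ioi_of_hasDerivAt_of_tendsto' hderiv hint hlim, hbeta]
  simp [hb]
  ring

theorem integral_pow_mul_one_sub_pow_eq_cBeta (n : ℕ) :
    ∫ s in (0 : ℝ)..1, (s : ℂ) ^ n * (1 - s) ^ n = cBeta (n + 1) (n + 1) := by
  have hre : 0 < ((n : ℂ) + 1).re := by
    simp only [Complex.add_re, Complex.natCast_re, Complex.one_re]; positivity
  have hne : Complex.Gamma ((n : ℂ) + 1 + (n + 1)) ≠ 0 :=
    Complex.Gamma_ne_zero_of_re_pos (by rw [Complex.add_re]; positivity)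
  rw [cBeta, Complex.Gamma_mul_Gamma_eq_betaIntegral hre hre, mul_div_cancel_left₀ _ hne,
    Complex.betaIntegral]
  simp [Complex.cpow_natCast]

theorem one_add_sub_mul_ne_zero {t : ℝ} (ht : 0 < t) {u : ℂ} (hu : ‖u‖ * |1 - t| < 1 + t) :
    (1 + t - u * (1 - t) : ℂ) ≠ 0 := by
  intro h0
  have h1 : u * ((1 - t : ℝ) : ℂ) = ((1 + t : ℝ) : ℂ) := by push_cast; linear_combination -h0
  have h2 := congrArg norm h1
  rw [norm_mul, Complex.norm_real, Complex.norm_real, Real.norm_eq_abs, Real.norm_eq_abs,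
    abs_of_pos (by linarith : 0 < 1 + t)] at h2
  linarith

theorem abs_one_sub_lt_one_add {t : ℝ} (ht : 0 < t) : |1 - t| < 1 + t :=
  abs_lt.2 ⟨by linarith, by linarith⟩

theorem exists_hasDerivAt_of_norm_le_one (n : ℕ) {t : ℝ} (ht : 0 < t) :
    ∃ G : ℂ → ℂ, ∀ u : ℂ, ‖u‖ ≤ 1 →
      HasDerivAt G ((1 - u ^ 2) ^ n / (1 + t - u * (1 - t)) ^ (n + 1)) u := by
  obtain ⟨R, hR1, hR⟩ : ∃ R : ℝ, 1 < R ∧ R * |1 - t| ≤ 1 + t := by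
    have habs := abs_one_sub_lt_one_add ht
    rcases (abs_nonneg (1 - t)).eq_or_lt with h | h
    · exact ⟨2, by norm_num, by rw [← h]; linarith⟩
    · exact ⟨(1 + t) / |1 - t|, (one_lt_div h).2 habs, (div_mul_cancel₀ _ h.ne').le⟩
  have hdenR (u : ℂ) (hu : ‖u‖ < R) : (1 + t - u * (1 - t) : ℂ) ≠ 0 := by
    rcases (abs_nonneg (1 - t)).eq_or_lt with h | h
    · exact one_add_sub_mul_ne_zero ht (by rw [← h]; linarith)
    · exact one_add_sub_mul_ne_zero ht (by nlinarith)
  have hdiff : DifferentiableOn ℂ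
      (fun u : ℂ => (1 - u ^ 2) ^ n / (1 + t - u * (1 - t)) ^ (n + 1)) (Metric.ball 0 R) := by
    refine DifferentiableOn.fun_div (by fun_prop) (by fun_prop) fun u hu => ?_
    exact pow_ne_zero _ (hdenR u (by simpa using hu))
  obtain ⟨G, hG⟩ := hdiff.isExactOn_ball
  refine ⟨G, fun u hu => hG u ?_⟩
  rw [Metric.mem_ball, dist_zero_right]
  exact hu.trans_lt hR1

theorem one_sub_I_mul_ofReal_ne_zero (x : ℝ) : (1 - Complex.I * x : ℂ) ≠ 0 := fun h0 => by
  simpa using congrArg Complex.re h0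

theorem cayley_pullback (n : ℕ) {t : ℝ} (ht : 0 < t) {x : ℝ} (hx : x ≠ 0) {w : ℂ}
    (hw : w = (1 + Complex.I * x) / (1 - Complex.I * x)) :
    (-1) ^ n / 2 ^ n * ((1 - w ^ 2) ^ n / (1 + t - w * (1 - t)) ^ (n + 1) *
        (2 * (-(-Complex.I) / (1 - Complex.I * x) ^ 2))) =
      ((((x : ℂ) + Complex.I) * (Complex.I - (x : ℂ)⁻¹ * t)) ^ (n + 1))⁻¹ * (x : ℂ)⁻¹ := by
  have h0 := one_sub_I_mul_ofReal_ne_zero x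
  have hx' : (x : ℂ) ≠ 0 := by exact_mod_cast hx
  have h1 : (t : ℂ) - Complex.I * x ≠ 0 := fun h => by
    have := congrArg Complex.re h
    simp at this
    exact ht.ne' this
  have e1 : 1 - w ^ 2 = -(4 * Complex.I * x / (1 - Complex.I * x) ^ 2) := by
    rw [hw]; field_simp; ring
  have e2 : 1 + t - w * (1 - t) = 2 * (t - Complex.I * x) / (1 - Complex.I * x) := by
    rw [hw]; field_simp; ring
  have e3 : ((x : ℂ) + Complex.I) * (Complex.I - (x : ℂ)⁻¹ * t) =
      -Complex.I * ((1 - Complex.I * x) * (t - Complex.I * x) / x) := by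
    field_simp
    linear_combination (-(x : ℂ) * t + Complex.I * x ^ 2) * Complex.I_sq
  have hI : ((-Complex.I) ^ (n + 1))⁻¹ = Complex.I ^ (n + 1) := by
    rw [← inv_pow, inv_neg, Complex.inv_I, neg_neg]
  have h4 : (4 : ℂ) ^ n = 2 ^ n * 2 ^ n := by rw [← mul_pow]; norm_num
  rw [e1, e2, e3, mul_pow (-Complex.I), mul_inv, hI, neg_pow (4 * Complex.I * x / _)]
  simp only [div_pow, mul_pow, h4]
  generalize 1 - Complex.I * (x : ℂ) = D at *
  generalize (t : ℂ) - Complex.I * x = E at *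
  rcases neg_one_pow_eq_or ℂ n with h | h <;> rw [h] <;> field_simp <;> ring

theorem integral_inv_pow_mul_inv_abs (n : ℕ) {t : ℝ} (ht : 0 < t)
    (hint : Integrable fun x : ℝ =>
      ((((x : ℂ) + Complex.I) * (Complex.I - (x : ℂ)⁻¹ * t)) ^ (n + 1))⁻¹ * ((|x|⁻¹ : ℝ) : ℂ)) :
    ∫ x : ℝ, ((((x : ℂ) + Complex.I) * (Complex.I - (x : ℂ)⁻¹ * t)) ^ (n + 1))⁻¹ *
        ((|x|⁻¹ : ℝ) : ℂ) =
      2 * (-1) ^ (n + 1) / 2 ^ n *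
        ∫ u in (-1 : ℝ)..1, (1 - (u : ℂ) ^ 2) ^ n / (1 + t - u * (1 - t)) ^ (n + 1) := by
  obtain ⟨G, hG⟩ := exists_hasDerivAt_of_norm_le_one n ht
  have hseg : ∫ u in (-1 : ℝ)..1, (1 - (u : ℂ) ^ 2) ^ n / (1 + t - u * (1 - t)) ^ (n + 1) =
      G 1 - G (-1) := by
    have hle (u : ℝ) (hu : u ∈ uIcc (-1 : ℝ) 1) : ‖(u : ℂ)‖ ≤ 1 := by
      rw [uIcc_of_le (by norm_num)] at hu
      rw [Complex.norm_real]
      exact abs_le.2 hu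
    rw [intervalIntegral.integral_eq_sub_of_hasDerivAt
      (fun u hu => (hG u (hle u hu)).comp_ofReal)]
    · simp
    · refine ContinuousOn.intervalIntegrable (ContinuousOn.div (by fun_prop) (by fun_prop) ?_)
      exact fun u hu => pow_ne_zero _ (one_add_sub_mul_ne_zero ht
        ((mul_le_of_le_one_left (abs_nonneg _) (hle u hu)).trans_lt (abs_one_sub_lt_one_add ht)))
  have hne := one_sub_I_mul_ofReal_ne_zero
  set w : ℝ → ℂ := fun x => -1 + 2 * (1 - Complex.I * x)⁻¹ with hw
  have hw' (x : ℝ) : w x = (1 + Complex.I * x) / (1 - Complex.I * x) := by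
    have := hne x
    simp only [hw]; field_simp; ring
  have hwnorm (x : ℝ) : ‖w x‖ ≤ 1 := by
    rw [hw', norm_div]
    refine div_le_one_of_le₀ (le_of_eq ?_) (norm_nonneg _)
    rw [← Complex.norm_conj]
    congr 1
    simp
    ring
  have hderiv (x : ℝ) : HasDerivAt (fun x => G (w x))
      ((1 - w x ^ 2) ^ n / (1 + t - w x * (1 - t)) ^ (n + 1) *
        (2 * (-(-Complex.I) / (1 - Complex.I * x) ^ 2))) x := by
    have hlin : HasDerivAt (fun v : ℝ => 1 - Complex.I * (v : ℂ)) (-Complex.I) x := by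
      simpa using ((hasDerivAt_id (x : ℂ)).comp_ofReal.const_mul Complex.I).const_sub 1
    exact (hG _ (hwnorm x)).comp x (((hlin.inv (hne x)).const_mul 2).const_add (-1))
  have hlim (l : Filter ℝ) (hl : l ≤ cobounded ℝ) : Tendsto (fun x => G (w x)) l (𝓝 (G (-1))) := by
    refine (hG (-1) (by simp)).continuousAt.tendsto.comp ?_
    have := (((tendsto_inv_mul_ofReal_add_cobounded
      (neg_ne_zero.2 Complex.I_ne_zero) 1).mono_left hl).const_mul 2).const_add (-1)
    simpa [hw, neg_add_eq_sub] using this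
  have hcont : Continuous fun x => G (w x) :=
    continuous_iff_continuousAt.2 fun x => (hderiv x).continuousAt
  have hpos := integral_Ioi_of_hasDerivAt_of_tendsto (a := 0)
    (hcont.const_mul ((-1) ^ n / 2 ^ n)).continuousWithinAt
    (fun x (hx : 0 < x) => by
      have := (hderiv x).const_mul ((-1) ^ n / 2 ^ n)
      rw [cayley_pullback n ht hx.ne' (hw' x)] at this
      simpa [abs_of_pos hx] using this)
    hint.integrableOn ((hlim _ IsOrderBornology.atTop_le_cobounded).const_mul ((-1) ^ n / 2 ^ n))
  have hneg := integral_Iic_of_hasDerivAt_of_tendsto (a := 0)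
    (hcont.const_mul (-((-1) ^ n / 2 ^ n))).continuousWithinAt
    (fun x (hx : x < 0) => by
      have := (hderiv x).const_mul (-((-1) ^ n / 2 ^ n))
      rw [neg_mul, cayley_pullback n ht hx.ne (hw' x)] at this
      simpa [abs_of_neg hx, inv_neg] using this)
    hint.integrableOn ((hlim _ IsOrderBornology.atBot_le_cobounded).const_mul (-((-1) ^ n / 2 ^ n)))
  have hw0 : w 0 = 1 := by simp [hw]; norm_num
  rw [← setIntegral_univ, ← Iic_union_Ioi (a := (0 : ℝ)),
    setIntegral_union (Iic_disjoint_Ioi le_rfl) measurableSet_Ioi hint.integrableOn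
      hint.integrableOn, hpos, hneg, hseg, hw0]
  ring

theorem le_normSq_of_mul_nonneg {t x y : ℝ} (hx : x ≠ 0) (hy : 0 ≤ y * (1 - t)) :
    (x ^ 2 + 1) * y ^ 2 + (1 + t ^ 2 / x ^ 2) ≤
      Complex.normSq (-((x : ℂ))⁻¹ * t + x * y + Complex.I * (y + 1)) := by
  have : Complex.normSq (-((x : ℂ))⁻¹ * t + x * y + Complex.I * (y + 1)) =
      (-x⁻¹ * t + x * y) ^ 2 + (y + 1) ^ 2 := by
    have : -((x : ℂ))⁻¹ * t + x * y + Complex.I * (y + 1) =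
        ((-x⁻¹ * t + x * y : ℝ) : ℂ) + ((y + 1 : ℝ) : ℂ) * Complex.I := by push_cast; ring
    rw [this, Complex.normSq_add_mul_I]
  rw [this]
  have e : (-x⁻¹ * t + x * y) ^ 2 + (y + 1) ^ 2 =
      (x ^ 2 + 1) * y ^ 2 + (1 + t ^ 2 / x ^ 2) + 2 * (y * (1 - t)) := by
    field_simp; ring
  linarith

theorem min_mul_le_abs_mul_normSq {t x y : ℝ} (ht : 0 < t) (hx : x ≠ 0)
    (hy : 0 ≤ y * (1 - t)) :
    min 1 t * (1 + x ^ 2) * |y| ≤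
      |x| * Complex.normSq (-((x : ℂ))⁻¹ * t + x * y + Complex.I * (y + 1)) := by
  refine le_trans ?_ (mul_le_mul_of_nonneg_left (le_normSq_of_mul_nonneg hx hy) (abs_nonneg x))
  have hc0 : 0 < min 1 t := lt_min one_pos ht
  have hc : min 1 t ^ 2 ≤ t ^ 2 := by gcongr; exact min_le_right _ _
  have hc1 : min 1 t ^ 2 ≤ 1 := by
    have := min_le_left 1 t
    nlinarith
  refine abs_le_of_sq_le_sq' ?_ (by positivity) |>.2
  have hx2 : 0 < x ^ 2 := by positivity
  have key : 4 * ((x ^ 2 + 1) * y ^ 2) * (x ^ 2 + t ^ 2) ≤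
      (|x| * ((x ^ 2 + 1) * y ^ 2 + (1 + t ^ 2 / x ^ 2))) ^ 2 := by
    rw [mul_pow, sq_abs]
    have : x ^ 2 * ((x ^ 2 + 1) * y ^ 2 + (1 + t ^ 2 / x ^ 2)) ^ 2 =
        4 * ((x ^ 2 + 1) * y ^ 2) * (x ^ 2 + t ^ 2) +
          x ^ 2 * ((x ^ 2 + 1) * y ^ 2 - (1 + t ^ 2 / x ^ 2)) ^ 2 := by
      field_simp; ring
    rw [this]
    have : 0 ≤ x ^ 2 * ((x ^ 2 + 1) * y ^ 2 - (1 + t ^ 2 / x ^ 2)) ^ 2 := by positivity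
    linarith
  refine le_trans ?_ key
  rw [mul_pow, mul_pow, sq_abs]
  have h1 : min 1 t ^ 2 * (1 + x ^ 2) ≤ x ^ 2 + t ^ 2 := by nlinarith
  have h2 : 0 ≤ (1 + x ^ 2) * y ^ 2 := by positivity
  have h3 : 0 ≤ (1 + x ^ 2) * y ^ 2 * (x ^ 2 + t ^ 2) := by positivity
  nlinarith [mul_le_mul_of_nonneg_right h1 h2]

/-- The integrand of the orbital integral of weight `2 * m` as a function on `ℝ × ℝ`. -/
noncomputable def orbitalIntegrand (m : ℕ) (t : ℝ) (p : ℝ × ℝ) : ℂ :=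
  (if 0 < p.2 * (1 - t) then ((p.2 * (1 - t) : ℝ) : ℂ) ^ m else 0) *
    ((-((p.1 : ℂ))⁻¹ * t + p.1 * p.2 + Complex.I * (p.2 + 1)) ^ (2 * m))⁻¹ *
    (((|p.1| * |p.2|)⁻¹ : ℝ) : ℂ)

theorem measurable_orbitalIntegrand (m : ℕ) (t : ℝ) : Measurable (orbitalIntegrand m t) := by
  unfold orbitalIntegrand
  refine Measurable.mul (Measurable.mul (Measurable.ite ?_ (by fun_prop) measurable_const) ?_) ?_
  · exact measurableSet_lt measurable_const (by fun_prop)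
  · fun_prop
  · fun_prop

theorem norm_orbitalIntegrand_le (n : ℕ) {t : ℝ} (ht : 0 < t) (p : ℝ × ℝ) :
    ‖orbitalIntegrand (n + 2) t p‖ ≤
      |1 - t| ^ (n + 2) / min 1 t * ((1 + p.1 ^ 2)⁻¹ * (1 + p.2 ^ 2)⁻¹) := by
  obtain ⟨x, y⟩ := p
  have hc : 0 < min 1 t := lt_min one_pos ht
  rcases eq_or_ne x 0 with rfl | hx
  · simp [orbitalIntegrand]; positivity
  by_cases hy : 0 < y * (1 - t)
  swap
  · simp [orbitalIntegrand, hy]; positivity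
  have hy0 : 0 < |y| := abs_pos.2 (by rintro rfl; simp at hy)
  have hx0 : 0 < |x| := abs_pos.2 hx
  have h1 := min_mul_le_abs_mul_normSq ht hx hy.le
  have h2 := le_normSq_of_mul_nonneg hx hy.le
  simp only [orbitalIntegrand, hy, if_true, norm_mul, norm_inv, norm_pow, Complex.norm_real,
    pow_mul, ← Complex.normSq_eq_norm_sq, Real.norm_eq_abs, abs_abs]
  generalize Complex.normSq _ = N at h1 h2 ⊢
  have h3 : 1 + y ^ 2 ≤ N := by
    have : 0 ≤ x ^ 2 * y ^ 2 + t ^ 2 / x ^ 2 := by positivity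
    nlinarith
  have hN : 0 < N := by nlinarith [sq_nonneg y]
  have h4 : |y| ≤ N := by nlinarith [sq_abs y, sq_nonneg (|y| - 1)]
  have e (X Y : ℝ) (hX : 0 < X) (hY : 0 < Y) :
      (Y * |1 - t|) ^ (n + 2) * (N ^ (n + 2))⁻¹ * (X * Y)⁻¹ =
        |1 - t| ^ (n + 2) * ((Y / N) ^ n * (Y / (X * N)) * N⁻¹) := by
    simp only [div_pow, mul_pow]
    field_simp
    ring
  rw [e _ _ hx0 hy0]
  have h5 : (|y| / N) ^ n ≤ 1 := pow_le_one₀ (by positivity) ((div_le_one hN).2 h4)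
  have h6 : |y| / (|x| * N) ≤ (min 1 t)⁻¹ * (1 + x ^ 2)⁻¹ := by
    rw [← mul_inv, ← one_div, div_le_div_iff₀ (by positivity) (by positivity)]
    linarith
  have h7 : N⁻¹ ≤ (1 + y ^ 2)⁻¹ := inv_anti₀ (by positivity) h3
  calc |1 - t| ^ (n + 2) * ((|y| / N) ^ n * (|y| / (|x| * N)) * N⁻¹)
      ≤ |1 - t| ^ (n + 2) * (1 * ((min 1 t)⁻¹ * (1 + x ^ 2)⁻¹) * (1 + y ^ 2)⁻¹) := by gcongr
    _ = |1 - t| ^ (n + 2) / min 1 t * ((1 + x ^ 2)⁻¹ * (1 + y ^ 2)⁻¹) := by ring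

theorem integrable_const_mul_inv_one_add_sq_prod (K : ℝ) :
    Integrable fun p : ℝ × ℝ => K * ((1 + p.1 ^ 2)⁻¹ * (1 + p.2 ^ 2)⁻¹) :=
  (integrable_inv_one_add_sq.mul_prod integrable_inv_one_add_sq).const_mul K

theorem integrable_orbitalIntegrand (n : ℕ) {t : ℝ} (ht : 0 < t) :
    Integrable (orbitalIntegrand (n + 2) t) :=
  (integrable_const_mul_inv_one_add_sq_prod _).mono'
    (measurable_orbitalIntegrand _ t).aestronglyMeasurable
    (.of_forall (norm_orbitalIntegrand_le n ht))

theorem integrable_orbitalIntegrand_right (n : ℕ) {t : ℝ} (ht : 0 < t) (x : ℝ) :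
    Integrable fun y => orbitalIntegrand (n + 2) t (x, y) :=
  ((integrable_inv_one_add_sq.const_mul (1 + x ^ 2)⁻¹).const_mul _).mono'
    ((measurable_orbitalIntegrand _ t).comp measurable_prodMk_left).aestronglyMeasurable
    (.of_forall fun y => norm_orbitalIntegrand_le n ht (x, y))

theorem integral_orbitalIntegrand_right (n : ℕ) {t : ℝ} (ht : 0 < t) (ht1 : t ≠ 1) (x : ℝ) :
    ∫ y, orbitalIntegrand (n + 2) t (x, y) =
      (1 - t) ^ (n + 2) * cBeta ((n + 1 : ℕ) + 1) ((n + 1 : ℕ) + 1) *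
        (((((x : ℂ) + Complex.I) * (Complex.I - (x : ℂ)⁻¹ * t)) ^ (n + 1 + 1))⁻¹ *
          ((|x|⁻¹ : ℝ) : ℂ)) := by
  rcases eq_or_ne x 0 with rfl | hx
  · simp [orbitalIntegrand]
  obtain ⟨s, hsabs, hs1⟩ : ∃ s : ℝ, |s| = 1 ∧ 0 < s * (1 - t) := by
    rcases ht1.lt_or_gt with h | h
    · exact ⟨1, by simp, by linarith⟩
    · exact ⟨-1, by simp, by linarith⟩
  have hs0 : s ≠ 0 := by rintro rfl; simp at hsabs
  set a : ℂ := s * (x + Complex.I) with ha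
  set b : ℂ := Complex.I - (x : ℂ)⁻¹ * t with hb
  have ha0 : a ≠ 0 := mul_ne_zero (by exact_mod_cast hs0) fun h => by
    simpa using congrArg Complex.im h
  have hb0 : b ≠ 0 := fun h => by
    have := congrArg Complex.im h
    rw [hb, ← Complex.ofReal_inv, ← Complex.ofReal_mul] at this
    simp at this
  have hW (v : ℝ) : -((x : ℂ))⁻¹ * t + x * (s * v : ℝ) + Complex.I * ((s * v : ℝ) + 1) =
      a * v + b := by
    rw [ha, hb]; push_cast; ring
  have hne (v : ℝ) (hv : 0 ≤ v) : a * v + b ≠ 0 := fun h0 => by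
    have h := le_normSq_of_mul_nonneg (t := t) (y := s * v) hx
      (by nlinarith [mul_nonneg hv hs1.le])
    rw [hW, h0, map_zero] at h
    have : 0 ≤ (x ^ 2 + 1) * (s * v) ^ 2 + t ^ 2 / x ^ 2 := by positivity
    linarith
  have hpos (v : ℝ) (hv : 0 < v) : orbitalIntegrand (n + 2) t (x, s * v) =
      (s * (1 - t)) ^ (n + 2) * ((|x|⁻¹ : ℝ) : ℂ) *
        ((v : ℂ) ^ (n + 1) / (a * v + b) ^ (2 * (n + 1 + 1))) := by
    have h0 : 0 < s * v * (1 - t) := by nlinarith [mul_pos hv hs1]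
    have h1 : (v : ℂ) ≠ 0 := by exact_mod_cast hv.ne'
    simp only [orbitalIntegrand, h0, if_true, hW, abs_mul, hsabs, abs_of_pos hv, one_mul]
    push_cast
    rw [mul_right_comm (s : ℂ), mul_pow, show (v : ℂ) ^ (n + 2) = v ^ (n + 1) * v by ring]
    field_simp
  have hneg (v : ℝ) (hv : v ≤ 0) : orbitalIntegrand (n + 2) t (x, s * v) = 0 := by
    have h0 : ¬ 0 < s * v * (1 - t) := by nlinarith [mul_nonneg (neg_nonneg.2 hv) hs1.le]
    simp only [orbitalIntegrand, h0, if_false, zero_mul]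
  have hint : Integrable fun v => orbitalIntegrand (n + 2) t (x, s * v) :=
    (integrable_orbitalIntegrand_right n ht x).comp_mul_left' hs0
  have hC : ((s : ℂ) * (1 - t)) ^ (n + 2) * ((|x|⁻¹ : ℝ) : ℂ) ≠ 0 := by
    refine mul_ne_zero (pow_ne_zero _ ?_) ?_
    · exact_mod_cast hs1.ne'
    · exact_mod_cast inv_ne_zero (abs_ne_zero.2 hx)
  have hint' : IntegrableOn
      (fun v : ℝ => (v : ℂ) ^ (n + 1) / (a * v + b) ^ (2 * (n + 1 + 1))) (Ioi 0) := by
    refine (integrable_const_mul_iff hC.isUnit _).1 ?_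
    exact (integrableOn_congr_fun (fun v hv => hpos v hv) measurableSet_Ioi).1 hint.integrableOn
  have hscale : ∫ y, orbitalIntegrand (n + 2) t (x, y) =
      ∫ v, orbitalIntegrand (n + 2) t (x, s * v) := by
    rw [Measure.integral_comp_mul_left fun y => orbitalIntegrand (n + 2) t (x, y), abs_inv,
      hsabs, inv_one, one_smul]
  rw [hscale, ← setIntegral_eq_integral_of_forall_compl_eq_zero (s := Ioi 0)
    fun v hv => hneg v (not_lt.1 hv), setIntegral_congr_fun measurableSet_Ioi fun v hv => hpos v hv,
    integral_const_mul, integral_Ioi_pow_div_pow (n + 1) ha0 hb0 hne hint',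
    integral_pow_mul_one_sub_pow_eq_cBeta, ha]
  rw [mul_assoc (s : ℂ), mul_pow (s : ℂ) (1 - t), mul_pow (s : ℂ)]
  have : (s : ℂ) ≠ 0 := by exact_mod_cast hs0
  field_simp

theorem integral_orbitalIntegrand (n : ℕ) {t : ℝ} (ht : 0 < t) (ht1 : t ≠ 1) :
    ∫ p, orbitalIntegrand (n + 2) t p =
      (1 - t) ^ (n + 2) * cBeta ((n + 1 : ℕ) + 1) ((n + 1 : ℕ) + 1) *
        (2 * (-1) ^ (n + 1 + 1) / 2 ^ (n + 1) *
          ∫ u in (-1 : ℝ)..1, (1 - (u : ℂ) ^ 2) ^ (n + 1) / (1 + t - u * (1 - t)) ^ (n + 1 + 1)) := by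
  have hint := (integrable_orbitalIntegrand n ht).integral_prod_left
  simp only [integral_orbitalIntegrand_right n ht ht1] at hint
  rw [Measure.volume_eq_prod, integral_prod _ (integrable_orbitalIntegrand n ht)]
  simp only [integral_orbitalIntegrand_right n ht ht1]
  rw [integral_const_mul]
  rcases eq_or_ne ((1 - t : ℂ) ^ (n + 2) * cBeta ((n + 1 : ℕ) + 1) ((n + 1 : ℕ) + 1)) 0 with h | h
  · rw [h, zero_mul, zero_mul]
  · rw [integral_inv_pow_mul_inv_abs (n + 1) ht ((integrable_const_mul_iff h.isUnit _).1 hint)]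

/-- the second assertion of Lemma 7.4 of the paper.  For `k` even, `k ≥ 4`,
and real `t > 0`, `t ≠ 1`, the double integral of
`(y(1−t))^{k/2} 1_{y(1−t)>0} (−x⁻¹t + xy + i(y+1))^{−k}` over `(ℝ∖{0})²` with respect to the
measure `(dy/|y|)(dx/|x|)` converges absolutely and equals
`2^{2−k/2} i^{−k} B(k/2,k/2) ∫_{−1}^1 (1−u²)^{k/2−1} ((1+t)/(1−t) − u)^{−k/2} du`. -/
theorem stmt_5 (k : ℕ) (hk : Even k) (hk4 : 4 ≤ k) (t : ℝ) (ht : 0 < t) (ht1 : t ≠ 1) :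
    IntegrableOn (fun p : ℝ × ℝ =>
        (if 0 < p.2 * (1 - t) then ((p.2 * (1 - t) : ℝ) : ℂ) ^ (k / 2) else 0) *
          (-((p.1 : ℂ))⁻¹ * (t : ℂ) + (p.1 : ℂ) * (p.2 : ℂ) +
              Complex.I * ((p.2 : ℂ) + 1)) ^ (-(k : ℤ)) *
          (((|p.1| * |p.2|)⁻¹ : ℝ) : ℂ))
      {p : ℝ × ℝ | p.1 ≠ 0 ∧ p.2 ≠ 0} ∧
    (∫ p in {p : ℝ × ℝ | p.1 ≠ 0 ∧ p.2 ≠ 0},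
        (if 0 < p.2 * (1 - t) then ((p.2 * (1 - t) : ℝ) : ℂ) ^ (k / 2) else 0) *
          (-((p.1 : ℂ))⁻¹ * (t : ℂ) + (p.1 : ℂ) * (p.2 : ℂ) +
              Complex.I * ((p.2 : ℂ) + 1)) ^ (-(k : ℤ)) *
          (((|p.1| * |p.2|)⁻¹ : ℝ) : ℂ)) =
      (2 : ℂ) ^ (2 - (k : ℤ) / 2) * Complex.I ^ (-(k : ℤ)) *
        cBeta ((k : ℂ) / 2) ((k : ℂ) / 2) *
        ∫ u in (-1 : ℝ)..1, ((1 - u ^ 2 : ℝ) : ℂ) ^ (k / 2 - 1) *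
          (((1 + t) / (1 - t) - u : ℝ) : ℂ) ^ (-((k : ℤ) / 2)) := by
  obtain ⟨m, rfl⟩ := hk
  obtain ⟨n, rfl⟩ : ∃ n, m = n + 2 := ⟨m - 2, by omega⟩
  have hk2 : (n + 2 + (n + 2)) / 2 = n + 2 := by omega
  have hkz : ((n + 2 + (n + 2) : ℕ) : ℤ) / 2 = (n + 2 : ℕ) := by omega
  have hkc : ((n + 2 + (n + 2) : ℕ) : ℂ) / 2 = ((n + 1 : ℕ) : ℂ) + 1 := by push_cast; ring
  have hF : (fun p : ℝ × ℝ =>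
      (if 0 < p.2 * (1 - t) then ((p.2 * (1 - t) : ℝ) : ℂ) ^ (n + 2) else 0) *
        (-((p.1 : ℂ))⁻¹ * (t : ℂ) + (p.1 : ℂ) * (p.2 : ℂ) +
            Complex.I * ((p.2 : ℂ) + 1)) ^ (-((n + 2 + (n + 2) : ℕ) : ℤ)) *
        (((|p.1| * |p.2|)⁻¹ : ℝ) : ℂ)) = orbitalIntegrand (n + 2) t := by
    funext p
    rw [orbitalIntegrand, zpow_neg, zpow_natCast, two_mul]
  rw [hk2, hkz, hkc, hF]
  refine ⟨(integrable_orbitalIntegrand n ht).integrableOn, ?_⟩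
  rw [setIntegral_eq_integral_of_forall_compl_eq_zero, integral_orbitalIntegrand n ht ht1]
  swap
  · intro p hp
    have : |p.1| * |p.2| = 0 := by
      by_contra h
      exact hp ⟨fun h0 => h (by simp [h0]), fun h0 => h (by simp [h0])⟩
    simp [orbitalIntegrand, this]
  have h1 : (1 - t : ℂ) ≠ 0 := sub_ne_zero.2 (by exact_mod_cast ht1.symm)
  have hu : (∫ u in (-1 : ℝ)..1, ((1 - u ^ 2 : ℝ) : ℂ) ^ (n + 2 - 1) *
      (((1 + t) / (1 - t) - u : ℝ) : ℂ) ^ (-((n + 2 : ℕ) : ℤ))) = (1 - t) ^ (n + 2) *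
      ∫ u in (-1 : ℝ)..1, (1 - (u : ℂ) ^ 2) ^ (n + 1) / (1 + t - u * (1 - t)) ^ (n + 1 + 1) := by
    rw [← intervalIntegral.integral_const_mul]
    congr 1 with u
    have e : (((1 + t) / (1 - t) - u : ℝ) : ℂ) = (1 + t - u * (1 - t)) / (1 - t) := by
      push_cast; field_simp
    rw [e, zpow_neg, zpow_natCast, div_pow, inv_div]
    push_cast
    ring
  have h2 : (2 : ℂ) ^ (2 - ((n + 2 : ℕ) : ℤ)) = 2 / 2 ^ (n + 1) := by
    rw [zpow_sub₀ two_ne_zero, zpow_natCast, pow_succ _ (n + 1)]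
    field_simp
  have hI : Complex.I ^ (-((n + 2 + (n + 2) : ℕ) : ℤ)) = (-1) ^ (n + 1 + 1) := by
    rw [zpow_neg, zpow_natCast, ← two_mul, pow_mul, Complex.I_sq, ← inv_pow, inv_neg, inv_one]
  rw [hu, h2, hI]
  ring
end

section
/- There exists an absolute constant C > 0 such that for every even integer k ≥ 4, every integer m ≥ 2, and every real u with 2^{m−1} < |2u+1| ≤ 2^m, one has | 2^{1−k/2} ∫_{−1}^{1} (1−t²)^{k/2−1} (2u+1−t)^{−k/2} dt | ≤ C · 2^{−k/2} · k^{−1/2} · |u(u+1)|^{−1/2} · (2^{m−1} − 1)^{−(k/2 − 1)}. -/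
open Real MeasureTheory Set in
theorem integral_one_sub_sq_pow_mul_zpow_le (n : ℕ) (hn : 0 < n) {M z : ℝ} (hM : 2 ≤ M)
    (hz : M < |z|) :
    |∫ t in (-1 : ℝ)..1, (1 - t ^ 2) ^ n * (z - t) ^ (-((n : ℤ) + 1))| ≤
      (M - 1)⁻¹ ^ n * (|z| - 1)⁻¹ * √(π / n) := by
  have hn' : (0 : ℝ) < n := by exact_mod_cast hn
  have hM1 : 0 < M - 1 := by linarith
  have hz1 : 0 < |z| - 1 := by linarith
  set A := (M - 1)⁻¹ ^ n * (|z| - 1)⁻¹ with hA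
  have hA0 : 0 ≤ A := by positivity
  have hint : Integrable (fun t : ℝ ↦ A * exp (-n * t ^ 2)) :=
    (integrable_exp_neg_mul_sq hn').const_mul A
  have hle : |∫ t in (-1 : ℝ)..1, (1 - t ^ 2) ^ n * (z - t) ^ (-((n : ℤ) + 1))| ≤
      ∫ t in (-1 : ℝ)..1, A * exp (-n * t ^ 2) := by
    rw [← Real.norm_eq_abs]
    refine intervalIntegral.norm_integral_le_of_norm_le (by norm_num)
      (ae_of_all _ fun t ht ↦ ?_) hint.intervalIntegrable
    have habs : |t| ≤ 1 := abs_le.2 ⟨ht.1.le, ht.2⟩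
    have hsq : t ^ 2 ≤ 1 := (sq_le_one_iff_abs_le_one t).2 habs
    have hd : |z| - 1 ≤ |z - t| := by linarith [abs_sub_abs_le_abs_sub z t]
    have hexp : (1 - t ^ 2) ^ n ≤ exp (-n * t ^ 2) := by
      calc (1 - t ^ 2) ^ n ≤ exp (-t ^ 2) ^ n := by
            gcongr
            linarith [add_one_le_exp (-t ^ 2)]
        _ = exp (-n * t ^ 2) := by rw [← exp_nat_mul]; ring_nf
    have hpow : |z - t| ^ (-((n : ℤ) + 1)) ≤ A := by
      rw [zpow_neg, ← Int.natCast_succ, zpow_natCast, ← inv_pow, pow_succ, hA]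
      gcongr
      linarith
    rw [norm_mul, norm_pow, norm_zpow, Real.norm_eq_abs, Real.norm_eq_abs,
      abs_of_nonneg (by linarith : 0 ≤ 1 - t ^ 2), mul_comm]
    gcongr
  refine hle.trans ?_
  rw [intervalIntegral.integral_of_le (by norm_num), ← integral_gaussian, ← integral_const_mul]
  exact setIntegral_le_integral hint (ae_of_all _ fun t ↦ by positivity)


/-- Lemma 7.9 of the paper.  There is an absolute constant `C > 0` so that for
every even `k ≥ 4`, every `m ≥ 2` and every real `u` with `2^{m−1} < |2u+1| ≤ 2^m`, one has
`|2^{1−k/2} ∫_{−1}^1 (1−t²)^{k/2−1}(2u+1−t)^{−k/2} dt|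
  ≤ C 2^{−k/2} k^{−1/2} |u(u+1)|^{−1/2} (2^{m−1}−1)^{−(k/2−1)}`. -/
theorem stmt_6 : ∃ C : ℝ, 0 < C ∧ ∀ k : ℕ, Even k → 4 ≤ k → ∀ m : ℕ, 2 ≤ m →
    ∀ u : ℝ, (2 : ℝ) ^ (m - 1) < |2 * u + 1| → |2 * u + 1| ≤ 2 ^ m →
      |(2 : ℝ) ^ (1 - (k : ℤ) / 2) *
          ∫ t in (-1 : ℝ)..1, (1 - t ^ 2) ^ (k / 2 - 1) * (2 * u + 1 - t) ^ (-((k : ℤ) / 2))| ≤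
        C * (2 : ℝ) ^ (-((k : ℤ) / 2)) * (k : ℝ) ^ (-(1 / 2 : ℝ)) *
          |u * (u + 1)| ^ (-(1 / 2 : ℝ)) * ((2 : ℝ) ^ (m - 1) - 1) ^ (-((k : ℤ) / 2 - 1)) := by
  refine ⟨4 * √Real.pi, by positivity, ?_⟩
  intro k hk hk4 m hm u hu _
  obtain ⟨n, rfl⟩ : ∃ n, k = 2 * (n + 1) := by
    obtain ⟨r, hr⟩ := hk
    exact ⟨r - 1, by omega⟩
  have hn : 0 < n := by omega
  have hn1 : (1 : ℝ) ≤ n := by exact_mod_cast hn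
  have hM : (2 : ℝ) ≤ 2 ^ (m - 1) := le_self_pow₀ (by norm_num) (by omega)
  have hnat : 2 * (n + 1) / 2 - 1 = n := by omega
  have hint : ((2 * (n + 1) : ℕ) : ℤ) / 2 = (n : ℤ) + 1 := by omega
  rw [hnat, hint, show (1 : ℤ) - (n + 1) = -(n + 1) + 1 by ring,
    show (n : ℤ) + 1 - 1 = n by ring, zpow_add₀ (by norm_num), zpow_one, abs_mul,
    abs_of_pos (by positivity : (0 : ℝ) < 2 ^ (-((n : ℤ) + 1)) * 2)]
  generalize (2 : ℝ) ^ (m - 1) = M at *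
  have hM1 : 0 < M - 1 := by linarith
  have hz1 : 0 < |2 * u + 1| - 1 := by linarith
  have hu0 : 0 < u * (u + 1) := by nlinarith [sq_abs (2 * u + 1)]
  have hsqrt : √(u * (u + 1)) ≤ |2 * u + 1| - 1 := by
    rw [Real.sqrt_le_left hz1.le]
    nlinarith [sq_abs (2 * u + 1)]
  have hinv : (|2 * u + 1| - 1)⁻¹ ≤ |u * (u + 1)| ^ (-(1 / 2 : ℝ)) := by
    rw [abs_of_pos hu0, Real.rpow_neg hu0.le, ← Real.sqrt_eq_rpow]
    exact inv_anti₀ (Real.sqrt_pos.2 hu0) hsqrt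
  have hgauss : √(Real.pi / n) ≤
      2 * √Real.pi * ((2 * (n + 1) : ℕ) : ℝ) ^ (-(1 / 2 : ℝ)) := by
    rw [Real.rpow_neg (by positivity), ← Real.sqrt_eq_rpow, ← div_eq_mul_inv,
      ← Real.sqrt_sq (zero_le_two : (0 : ℝ) ≤ 2), ← Real.sqrt_mul (by positivity),
      ← Real.sqrt_div (by positivity)]
    apply Real.sqrt_le_sqrt
    rw [div_le_div_iff₀ (by positivity) (by positivity)]
    push_cast
    nlinarith [Real.pi_pos]
  calc _ ≤ 2 ^ (-((n : ℤ) + 1)) * 2 *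
        ((M - 1)⁻¹ ^ n * |u * (u + 1)| ^ (-(1 / 2 : ℝ)) *
          (2 * √Real.pi * ((2 * (n + 1) : ℕ) : ℝ) ^ (-(1 / 2 : ℝ)))) := by
        gcongr
        refine (integral_one_sub_sq_pow_mul_zpow_le n hn hM hu).trans ?_
        gcongr
    _ = _ := by
        rw [zpow_neg (M - 1), zpow_natCast, inv_pow]
        ring
end

section
/- There exists an absolute constant C > 0 such that for every even integer k ≥ 4 and every real u with 1 < |2u+1| ≤ 2, one has | 2^{1−k/2} ∫_{−1}^{1} (1−t²)^{k/2−1} (2u+1−t)^{−k/2} dt | ≤ C · k^{−1/2} · |u(u+1)|^{−1/2}. -/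
/-- With `s = x - t` and `w = √(x² - 1)`, the base `(1 - t²) / (2 (x - t))` equals
`x - w - (s - w)² / (2 s)`, which gives a Gaussian-type bound on its powers. -/
lemma pow_base_le_exp {x t : ℝ} (n : ℕ) (hx : 1 < x) (ht : t ∈ Set.Icc (-1 : ℝ) 1) :
    ((1 - t ^ 2) / (2 * (x - t))) ^ n ≤
      Real.exp (-(n * ((x - t - √(x ^ 2 - 1)) ^ 2 / (2 * (x - t))))) := by
  obtain ⟨h1, h2⟩ := ht
  have hs : 0 < x - t := by linarith
  set w := √(x ^ 2 - 1) with hw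
  have hw2 : w ^ 2 = x ^ 2 - 1 := Real.sq_sqrt (by nlinarith)
  have hw0 : 0 ≤ w := Real.sqrt_nonneg _
  have hxw : x - w ≤ 1 := by nlinarith
  have hbase : (1 - t ^ 2) / (2 * (x - t)) = x - w - (x - t - w) ^ 2 / (2 * (x - t)) := by
    field_simp
    linear_combination hw2
  have hexp := Real.add_one_le_exp (-((x - t - w) ^ 2 / (2 * (x - t))))
  calc ((1 - t ^ 2) / (2 * (x - t))) ^ n
      ≤ (Real.exp (-((x - t - w) ^ 2 / (2 * (x - t))))) ^ n := by
        apply pow_le_pow_left₀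
        · exact div_nonneg (by nlinarith) (by linarith)
        · rw [hbase]; linarith
    _ = _ := by rw [← Real.exp_nat_mul]; congr 1; ring

lemma div_mul_exp_le {n s w : ℝ} (hn : 0 < n) (hs : 0 < s) (hs3 : s ≤ 3) (hw : 0 < w) :
    Real.exp (-(n * ((s - w) ^ 2 / (2 * s)))) / s ≤
      (Real.exp (-(n / 6) * (s - w) ^ 2) + √2 / √n * (1 / √s)) / w := by
  set E := Real.exp (-(n * ((s - w) ^ 2 / (2 * s)))) with hE
  have hE0 : 0 < E := Real.exp_pos _
  have hEG : E ≤ Real.exp (-(n / 6) * (s - w) ^ 2) := by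
    apply Real.exp_le_exp.mpr
    have : (s - w) ^ 2 / 6 ≤ (s - w) ^ 2 / (2 * s) := by gcongr; linarith
    nlinarith
  have hkey : (w - s) * E ≤ √2 / √n * √s := by
    have hEE : n * (w - s) ^ 2 * E ^ 2 ≤ 2 * s := by
      have h := Real.add_one_le_exp (2 * (n * ((s - w) ^ 2 / (2 * s))))
      have hmul : E ^ 2 * Real.exp (2 * (n * ((s - w) ^ 2 / (2 * s)))) = 1 := by
        rw [hE, ← Real.exp_nat_mul, ← Real.exp_add, Real.exp_eq_one_iff]
        push_cast; ring
      have hy : n * (w - s) ^ 2 = s * (2 * (n * ((s - w) ^ 2 / (2 * s)))) := by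
        field_simp; ring
      have h3 : 2 * (n * ((s - w) ^ 2 / (2 * s))) * E ^ 2 ≤ 1 := by
        nlinarith [sq_nonneg E]
      rw [hy]
      nlinarith
    rw [← Real.sqrt_div (by norm_num), ← Real.sqrt_mul (by positivity)]
    apply Real.le_sqrt_of_sq_le
    rw [div_mul_eq_mul_div, le_div_iff₀ hn]
    linarith
  rw [div_le_div_iff₀ hs hw]
  have hss : 1 / √s * s = √s := by
    rw [one_div, inv_mul_eq_div, Real.div_sqrt]
  have : (Real.exp (-(n / 6) * (s - w) ^ 2) + √2 / √n * (1 / √s)) * s =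
      Real.exp (-(n / 6) * (s - w) ^ 2) * s + √2 / √n * √s := by
    rw [add_mul, mul_assoc, hss]
  rw [this]
  nlinarith

lemma integral_gaussian_sub_le {b : ℝ} (hb : 0 < b) (c : ℝ) :
    ∫ t in (-1 : ℝ)..1, Real.exp (-b * (c - t) ^ 2) ≤ √(Real.pi / b) := by
  rw [intervalIntegral.integral_of_le (by norm_num), ← integral_gaussian b,
    ← MeasureTheory.integral_sub_left_eq_self (fun t => Real.exp (-b * t ^ 2)) MeasureTheory.volume c]
  apply MeasureTheory.setIntegral_le_integral
  · exact (integrable_exp_neg_mul_sq hb).comp_sub_left c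
  · exact Filter.Eventually.of_forall fun t => (Real.exp_pos _).le

lemma intervalIntegrable_one_div_sqrt_sub {x : ℝ} (hx : 1 < x) :
    IntervalIntegrable (fun t => 1 / √(x - t)) MeasureTheory.volume (-1) 1 := by
  apply ContinuousOn.intervalIntegrable
  rw [Set.uIcc_of_le (by norm_num)]
  intro t ht
  have : √(x - t) ≠ 0 := (Real.sqrt_pos.mpr (by linarith [ht.2])).ne'
  apply ContinuousAt.continuousWithinAt
  fun_prop (disch := assumption)

lemma integral_one_div_sqrt_sub_le {x : ℝ} (hx : 1 < x) :
    ∫ t in (-1 : ℝ)..1, 1 / √(x - t) ≤ 2 * √(x + 1) := by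
  have h : ∫ t in (-1 : ℝ)..1, 1 / √(x - t) = -2 * √(x - 1) - -2 * √(x - -1) := by
    apply intervalIntegral.integral_eq_sub_of_hasDerivAt (f := fun t => -2 * √(x - t))
    · intro t ht
      rw [Set.uIcc_of_le (by norm_num)] at ht
      have hpos : 0 < x - t := by linarith [ht.2]
      have hd := (((hasDerivAt_id' t).const_sub x).sqrt hpos.ne').const_mul (-2)
      rwa [show -2 * (-1 / (2 * √(x - t))) = 1 / √(x - t) by field_simp] at hd
    · exact intervalIntegrable_one_div_sqrt_sub hx
  rw [h, sub_neg_eq_add]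
  linarith [Real.sqrt_nonneg (x - 1)]

lemma abs_integral_pow_div_le {x : ℝ} {n : ℕ} (hn : 0 < n) (hx : 1 < x) (hx2 : x ≤ 2) :
    |∫ t in (-1 : ℝ)..1, ((1 - t ^ 2) / (2 * (x - t))) ^ n / (x - t)| ≤
      10 / (√(x ^ 2 - 1) * √n) := by
  set w := √(x ^ 2 - 1) with hw
  have hw0 : 0 < w := Real.sqrt_pos.mpr (by nlinarith)
  have hn0 : (0 : ℝ) < n := by exact_mod_cast hn
  have hsn : 0 < √(n : ℝ) := Real.sqrt_pos.mpr hn0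
  have hgi : IntervalIntegrable (fun t => Real.exp (-((n : ℝ) / 6) * (x - w - t) ^ 2))
      MeasureTheory.volume (-1) 1 := by
    apply Continuous.intervalIntegrable; fun_prop
  have hsi := (intervalIntegrable_one_div_sqrt_sub hx).const_mul (√2 / √n)
  have hbound : |∫ t in (-1 : ℝ)..1, ((1 - t ^ 2) / (2 * (x - t))) ^ n / (x - t)| ≤
      ∫ t in (-1 : ℝ)..1, (Real.exp (-((n : ℝ) / 6) * (x - w - t) ^ 2) +
        √2 / √n * (1 / √(x - t))) / w := by
    rw [← Real.norm_eq_abs]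
    apply intervalIntegral.norm_integral_le_of_norm_le (by norm_num)
    · refine Filter.Eventually.of_forall fun t ht => ?_
      have hs : 0 < x - t := by linarith [ht.2]
      have hb0 : 0 ≤ (1 - t ^ 2) / (2 * (x - t)) :=
        div_nonneg (by nlinarith [ht.1, ht.2]) (by linarith)
      rw [Real.norm_of_nonneg (by positivity), sub_right_comm x w t]
      refine le_trans ?_ (div_mul_exp_le hn0 hs (by linarith [ht.1]) hw0)
      gcongr
      exact pow_base_le_exp n hx ⟨ht.1.le, ht.2⟩
    · exact (hgi.add hsi).div_const w
  refine hbound.trans ?_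
  rw [intervalIntegral.integral_div, intervalIntegral.integral_add hgi hsi,
    intervalIntegral.integral_const_mul, ← div_div, div_right_comm]
  gcongr
  have h1 := integral_gaussian_sub_le (b := (n : ℝ) / 6) (by positivity) (x - w)
  have h2 := integral_one_div_sqrt_sub_le hx
  have h3 : √(Real.pi / ((n : ℝ) / 6)) ≤ 5 / √n := by
    rw [div_div_eq_mul_div, Real.sqrt_div (by positivity)]
    gcongr
    rw [Real.sqrt_le_left (by norm_num)]
    linarith [Real.pi_lt_four]
  have h4 : √2 / √n * (2 * √(x + 1)) ≤ 5 / √n := by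
    rw [div_mul_eq_mul_div]
    gcongr
    have : √2 * √(x + 1) ≤ 5 / 2 := by
      rw [← Real.sqrt_mul (by norm_num), Real.sqrt_le_left (by norm_num)]
      linarith
    linarith
  have h5 : √2 / √n * ∫ t in (-1 : ℝ)..1, 1 / √(x - t) ≤ 5 / √n :=
    le_trans (by gcongr) h4
  calc _ ≤ 5 / √(n : ℝ) + 5 / √n := add_le_add (h1.trans h3) h5
    _ = 10 / √n := by ring

lemma abs_integral_pow_div_le_of_abs {x : ℝ} {n : ℕ} (hn : 0 < n) (hx : 1 < |x|)
    (hx2 : |x| ≤ 2) :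
    |∫ t in (-1 : ℝ)..1, ((1 - t ^ 2) / (2 * (x - t))) ^ n / (x - t)| ≤
      10 / (√(x ^ 2 - 1) * √n) := by
  rcases abs_choice x with h | h
  · rw [h] at hx hx2
    exact abs_integral_pow_div_le hn hx hx2
  · rw [h] at hx hx2
    have hneg := intervalIntegral.integral_comp_neg (a := -1) (b := 1)
      (fun t : ℝ => ((1 - t ^ 2) / (2 * (x - t))) ^ n / (x - t))
    rw [neg_neg] at hneg
    have hparity : ∀ t : ℝ, ((1 - (-t) ^ 2) / (2 * (x - -t))) ^ n / (x - -t) =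
        (-1) ^ (n + 1) * (((1 - t ^ 2) / (2 * (-x - t))) ^ n / (-x - t)) := by
      intro t
      have h1 : x - -t = -(-x - t) := by ring
      rw [h1, neg_sq, mul_neg, div_neg, div_neg,
        neg_pow ((1 - t ^ 2) / (2 * (-x - t))) n, pow_succ]
      ring
    simp_rw [hparity] at hneg
    rw [← hneg, intervalIntegral.integral_const_mul, abs_mul, abs_pow, abs_neg, abs_one,
      one_pow, one_mul, ← neg_sq x]
    exact abs_integral_pow_div_le hn hx hx2


/-- Lemma 7.10 of the paper.  There is an absolute constant `C > 0` so that for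
every even `k ≥ 4` and every real `u` with `1 < |2u+1| ≤ 2`, one has
`|2^{1−k/2} ∫_{−1}^1 (1−t²)^{k/2−1}(2u+1−t)^{−k/2} dt| ≤ C k^{−1/2} |u(u+1)|^{−1/2}`. -/
theorem stmt_7 : ∃ C : ℝ, 0 < C ∧ ∀ k : ℕ, Even k → 4 ≤ k →
    ∀ u : ℝ, 1 < |2 * u + 1| → |2 * u + 1| ≤ 2 →
      |(2 : ℝ) ^ (1 - (k : ℤ) / 2) *
          ∫ t in (-1 : ℝ)..1, (1 - t ^ 2) ^ (k / 2 - 1) * (2 * u + 1 - t) ^ (-((k : ℤ) / 2))| ≤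
        C * (k : ℝ) ^ (-(1 / 2 : ℝ)) * |u * (u + 1)| ^ (-(1 / 2 : ℝ)) := by
  refine ⟨10, by norm_num, ?_⟩
  rintro k ⟨r, rfl⟩ hk u hu1 hu2
  obtain ⟨n, rfl⟩ : ∃ n, r = n + 1 := ⟨r - 1, by omega⟩
  have hn : 0 < n := by omega
  have hn0 : (0 : ℝ) < n := by exact_mod_cast hn
  have hz : (((n + 1 + (n + 1) : ℕ) : ℤ) / 2) = ((n + 1 : ℕ) : ℤ) := by omega
  have hnat : (n + 1 + (n + 1)) / 2 - 1 = n := by omega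
  have hone : (1 : ℤ) - ((n + 1 : ℕ) : ℤ) = -(n : ℤ) := by omega
  have hfun : ∀ t : ℝ, (2 : ℝ) ^ (-(n : ℤ)) *
      ((1 - t ^ 2) ^ n * (2 * u + 1 - t) ^ (-((n + 1 : ℕ) : ℤ))) =
      ((1 - t ^ 2) / (2 * (2 * u + 1 - t))) ^ n / (2 * u + 1 - t) := by
    intro t
    rw [zpow_neg, zpow_neg, zpow_natCast, zpow_natCast, pow_succ _ n, div_pow, mul_pow,
      mul_inv, div_eq_mul_inv, div_eq_mul_inv, mul_inv]
    ring
  rw [hz, hnat, hone, ← intervalIntegral.integral_const_mul]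
  simp_rw [hfun]
  refine (abs_integral_pow_div_le_of_abs hn hu1 hu2).trans ?_
  have hsq : 1 < (2 * u + 1) ^ 2 := by
    rw [← sq_abs]; nlinarith
  have huu : 0 < u * (u + 1) := by nlinarith
  have hw : √((2 * u + 1) ^ 2 - 1) = 2 * √(u * (u + 1)) := by
    rw [show (2 * u + 1) ^ 2 - 1 = 2 ^ 2 * (u * (u + 1)) by ring, Real.sqrt_mul (by norm_num),
      Real.sqrt_sq (by norm_num)]
  have hk4 : √((n + 1 + (n + 1) : ℕ) : ℝ) ≤ 2 * √n := by
    rw [Real.sqrt_le_left (by positivity), mul_pow, Real.sq_sqrt hn0.le]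
    have : (1 : ℝ) ≤ n := by exact_mod_cast hn
    push_cast
    linarith
  have hkpos : 0 < √((n + 1 + (n + 1) : ℕ) : ℝ) := Real.sqrt_pos.mpr (by positivity)
  have hupos : 0 < √(u * (u + 1)) := Real.sqrt_pos.mpr huu
  rw [abs_of_pos huu, Real.rpow_neg (by positivity), Real.rpow_neg huu.le, ← Real.sqrt_eq_rpow,
    ← Real.sqrt_eq_rpow, hw, mul_assoc 10, ← mul_inv, ← div_eq_mul_inv]
  gcongr 10 / ?_
  nlinarith
end

section
/- Let k be an even positive integer, let y > 0 be real, and let s ∈ ℂ with 0 < Re(s) < k. Then ∫_0^∞ x^{s−1} (x + i(1+y))^{−k} dx = e^{iπ s/2} · i^{−k} · (1+y)^{s−k} · B(s, k−s), where (1+y)^{s−k} = exp((s−k) log(1+y)). -/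
open MeasureTheory

open Set Filter Topology

/-- The integral `∫₀^∞ x^(s-1) (x+a)^(-n) dx`, as a function of the complex shift `a`. -/
noncomputable def shiftedPowMellin (n : ℕ) (s a : ℂ) : ℂ :=
  ∫ x in Ioi (0 : ℝ), (x : ℂ) ^ (s - 1) * ((x : ℂ) + a) ^ (-(n : ℤ))

theorem integrableOn_rpow_mul_add_zpow_neg {n : ℕ} {σ δ : ℝ} (hδ : 0 < δ) (h0 : 0 < σ)
    (hn : σ < n) :
    IntegrableOn (fun x : ℝ => x ^ (σ - 1) * (x + δ) ^ (-(n : ℤ))) (Ioi 0) := by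
  have hcont : ContinuousOn (fun x : ℝ => (x + δ) ^ (-(n : ℤ))) (Ioi 0) := by
    intro x hx
    have hx' : (0 : ℝ) < x := hx
    have hne : x + δ ≠ 0 := by positivity
    exact ((continuousAt_id.add continuousAt_const).zpow₀ _ (Or.inl hne)).continuousWithinAt
  refine mellin_convergent_of_isBigO_scalar (a := n) (b := 0)
    (hcont.locallyIntegrableOn measurableSet_Ioi) ?_ hn ?_ h0
  · refine Asymptotics.IsBigO.of_bound 1 ?_
    filter_upwards [eventually_gt_atTop 0] with x hx
    rw [one_mul, Real.rpow_neg hx.le, Real.rpow_natCast, zpow_neg, zpow_natCast,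
      Real.norm_of_nonneg (by positivity), Real.norm_of_nonneg (by positivity)]
    gcongr
    linarith
  · refine Asymptotics.IsBigO.of_bound ((δ ^ n)⁻¹) ?_
    filter_upwards [self_mem_nhdsWithin] with x hx
    have hx' : (0 : ℝ) < x := hx
    rw [neg_zero, Real.rpow_zero, norm_one, mul_one, zpow_neg, zpow_natCast,
      Real.norm_of_nonneg (by positivity)]
    gcongr
    linarith

theorem half_add_le_norm_add {x δ : ℝ} {a : ℂ} (ha : δ ≤ a.re + a.im) :
    (x + δ) / 2 ≤ ‖(x : ℂ) + a‖ := by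
  have hre := Complex.re_le_norm ((x : ℂ) + a)
  have him := (le_abs_self _).trans (Complex.abs_im_le_norm ((x : ℂ) + a))
  simp only [Complex.add_re, Complex.add_im, Complex.ofReal_re, Complex.ofReal_im] at hre him
  linarith

theorem ofReal_add_ne_zero {x : ℝ} {a : ℂ} (hx : 0 < x) (ha : 0 < a.re + a.im) :
    (x : ℂ) + a ≠ 0 := by
  have := half_add_le_norm_add (x := x) (le_refl (a.re + a.im))
  rw [← norm_pos_iff]
  linarith

theorem norm_cpow_mul_add_zpow_neg_le (n : ℕ) {x δ : ℝ} {s a : ℂ} (hx : 0 < x) (hδ : 0 < δ)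
    (ha : δ ≤ a.re + a.im) :
    ‖(x : ℂ) ^ (s - 1) * ((x : ℂ) + a) ^ (-(n : ℤ))‖ ≤
      2 ^ n * (x ^ (s.re - 1) * (x + δ) ^ (-(n : ℤ))) := by
  have hle := half_add_le_norm_add (x := x) ha
  rw [norm_mul, Complex.norm_cpow_eq_rpow_re_of_pos hx, Complex.sub_re, Complex.one_re, norm_zpow,
    zpow_neg, zpow_neg, zpow_natCast, zpow_natCast]
  have hpow : (‖(x : ℂ) + a‖ ^ n)⁻¹ ≤ (((x + δ) / 2) ^ n)⁻¹ := by gcongr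
  calc _ ≤ x ^ (s.re - 1) * (((x + δ) / 2) ^ n)⁻¹ := by gcongr
    _ = _ := by rw [div_pow, inv_div]; ring

theorem aestronglyMeasurable_cpow_mul_add_zpow_neg (n : ℕ) (s : ℂ) {a : ℂ}
    (ha : 0 < a.re + a.im) :
    AEStronglyMeasurable (fun x : ℝ => (x : ℂ) ^ (s - 1) * ((x : ℂ) + a) ^ (-(n : ℤ)))
      (volume.restrict (Ioi 0)) := by
  refine ContinuousOn.aestronglyMeasurable (fun x hx => ?_) measurableSet_Ioi
  have hx' : (0 : ℝ) < x := hx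
  refine ((Complex.continuousAt_ofReal_cpow_const _ _ (Or.inr hx'.ne')).mul ?_).continuousWithinAt
  exact (Complex.continuous_ofReal.continuousAt.add continuousAt_const).zpow₀ _
    (Or.inl (ofReal_add_ne_zero hx' ha))

theorem integrableOn_cpow_mul_add_zpow_neg {n : ℕ} {s a : ℂ} (h0 : 0 < s.re) (hn : s.re < n)
    (ha : 0 < a.re + a.im) :
    IntegrableOn (fun x : ℝ => (x : ℂ) ^ (s - 1) * ((x : ℂ) + a) ^ (-(n : ℤ))) (Ioi 0) := by
  refine Integrable.mono' ((integrableOn_rpow_mul_add_zpow_neg ha h0 hn).const_mul (2 ^ n))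
    (aestronglyMeasurable_cpow_mul_add_zpow_neg n s ha) ?_
  filter_upwards [ae_restrict_mem measurableSet_Ioi] with x hx
  exact norm_cpow_mul_add_zpow_neg_le n hx ha le_rfl

theorem differentiableAt_shiftedPowMellin {n : ℕ} {s a : ℂ} (h0 : 0 < s.re) (hn : s.re < n)
    (ha : 0 < a.re + a.im) : DifferentiableAt ℂ (shiftedPowMellin n s) a := by
  obtain ⟨δ, hδ, hδa⟩ := exists_between ha
  have hL : Continuous fun z : ℂ => z.re + z.im := Complex.continuous_re.add Complex.continuous_im
  have hmem : {z : ℂ | δ < z.re + z.im} ∈ 𝓝 a := (isOpen_lt continuous_const hL).mem_nhds hδa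
  have hn' : s.re < (n + 1 : ℕ) := by push_cast; linarith
  refine (hasDerivAt_integral_of_dominated_loc_of_deriv_le hmem
    (F := fun z x => (x : ℂ) ^ (s - 1) * ((x : ℂ) + z) ^ (-(n : ℤ)))
    (μ := volume.restrict (Ioi 0))
    (F' := fun z x => -(n : ℂ) * ((x : ℂ) ^ (s - 1) * ((x : ℂ) + z) ^ (-((n + 1 : ℕ) : ℤ))))
    (bound := fun x => n * (2 ^ (n + 1) * (x ^ (s.re - 1) * (x + δ) ^ (-((n + 1 : ℕ) : ℤ)))))
    ?_ (integrableOn_cpow_mul_add_zpow_neg h0 hn ha)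
    ((aestronglyMeasurable_cpow_mul_add_zpow_neg (n + 1) s ha).const_mul _) ?_
    (((integrableOn_rpow_mul_add_zpow_neg hδ h0 hn').const_mul _).const_mul _) ?_).2.differentiableAt
  · filter_upwards [hmem] with z hz
    exact aestronglyMeasurable_cpow_mul_add_zpow_neg n s (hδ.trans hz)
  · filter_upwards [ae_restrict_mem measurableSet_Ioi] with x hx z hz
    rw [norm_mul, norm_neg, Complex.norm_natCast]
    gcongr
    exact norm_cpow_mul_add_zpow_neg_le (n + 1) hx hδ (le_of_lt hz)
  · filter_upwards [ae_restrict_mem measurableSet_Ioi] with x hx z hz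
    have hd := ((hasDerivAt_zpow (-(n : ℤ)) _
      (Or.inl (ofReal_add_ne_zero hx (hδ.trans hz)))).comp_const_add (x : ℂ) z).const_mul
        ((x : ℂ) ^ (s - 1))
    convert! hd using 1
    push_cast
    rw [neg_add, ← sub_eq_add_neg]
    ring

theorem image_div_add_Ioi {a : ℝ} (ha : 0 < a) :
    (fun x : ℝ => x / (x + a)) '' Ioi 0 = Ioo 0 1 := by
  ext u
  constructor
  · rintro ⟨x, hx, rfl⟩
    have hx' : (0 : ℝ) < x := hx
    exact ⟨by positivity, (div_lt_one (by positivity)).2 (by linarith)⟩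
  · rintro ⟨hu0, hu1⟩
    have h1 : 0 < 1 - u := by linarith
    refine ⟨u * a / (1 - u), mem_Ioi.2 (by positivity), ?_⟩
    field_simp
    ring

theorem betaIntegral_eq_shiftedPowMellin {n : ℕ} (s : ℂ) {a : ℝ} (ha : 0 < a) :
    Complex.betaIntegral s (n - s) = (a : ℂ) ^ ((n : ℂ) - s) * shiftedPowMellin n s a := by
  have hderiv : ∀ x ∈ Ioi (0 : ℝ), HasDerivWithinAt (fun x : ℝ => x / (x + a))
      (a / (x + a) ^ 2) (Ioi 0) x := by
    intro x hx
    have hx' : (0 : ℝ) < x := hx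
    have hne : x + a ≠ 0 := by positivity
    convert! ((hasDerivAt_id x).div ((hasDerivAt_id x).add_const a) hne).hasDerivWithinAt using 1
    simp
  have hinj : InjOn (fun x : ℝ => x / (x + a)) (Ioi 0) := by
    intro x hx z hz hxz
    have hx' : (0 : ℝ) < x := hx
    have hz' : (0 : ℝ) < z := hz
    have h := (div_eq_div_iff (by positivity) (by positivity)).1 hxz
    exact mul_right_cancel₀ ha.ne' (by linarith)
  rw [Complex.betaIntegral, intervalIntegral.integral_of_le zero_le_one, integral_Ioc_eq_integral_Ioo,
    ← image_div_add_Ioi ha,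
    integral_image_eq_integral_abs_deriv_smul measurableSet_Ioi hderiv hinj, shiftedPowMellin,
    ← integral_const_mul]
  refine setIntegral_congr_fun measurableSet_Ioi fun x hx => ?_
  have hx' : (0 : ℝ) < x := hx
  have hxa : 0 < x + a := by positivity
  have ha0 : (a : ℂ) ≠ 0 := by exact_mod_cast ha.ne'
  have hb0 : ((x + a : ℝ) : ℂ) ≠ 0 := by exact_mod_cast hxa.ne'
  have hsub : 1 - ((x / (x + a) : ℝ) : ℂ) = ((a / (x + a) : ℝ) : ℂ) := by
    norm_cast
    field_simp
    ring
  have hdiv : ∀ {p q : ℝ} (w : ℂ), 0 < p → 0 < q →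
      ((p / q : ℝ) : ℂ) ^ w = (p : ℂ) ^ w * (q : ℂ) ^ (-w) := by
    intro p q w hp hq
    rw [div_eq_mul_inv, Complex.ofReal_mul, Complex.mul_cpow_ofReal_nonneg hp.le
      (inv_nonneg.2 hq.le), Complex.cpow_neg, ← Complex.inv_cpow, Complex.ofReal_inv]
    rw [Complex.arg_ofReal_of_nonneg hq.le]
    exact Real.pi_pos.ne
  have hpow : ((x + a : ℝ) : ℂ) ^ (-(s - 1)) * ((x + a : ℝ) : ℂ) ^ (-((n : ℂ) - s - 1)) =
      ((x + a : ℝ) : ℂ) ^ (-(n : ℤ)) * ((x + a : ℝ) : ℂ) ^ 2 := by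
    rw [← Complex.cpow_add _ _ hb0, ← Complex.cpow_intCast, ← Complex.cpow_ofNat,
      ← Complex.cpow_add _ _ hb0]
    congr 1
    push_cast
    ring
  have hapow : (a : ℂ) ^ ((n : ℂ) - s) = (a : ℂ) ^ ((n : ℂ) - s - 1) * a := by
    rw [Complex.cpow_sub _ 1 ha0, Complex.cpow_one, div_mul_cancel₀ _ ha0]
  rw [abs_of_pos (by positivity), hsub, hdiv _ hx' hxa, hdiv _ ha hxa, hapow, Complex.real_smul,
    ← Complex.ofReal_add]
  calc _ = ((a / (x + a) ^ 2 : ℝ) : ℂ) * ((x : ℂ) ^ (s - 1) * (a : ℂ) ^ ((n : ℂ) - s - 1)) *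
        (((x + a : ℝ) : ℂ) ^ (-(s - 1)) * ((x + a : ℝ) : ℂ) ^ (-((n : ℂ) - s - 1))) := by ring
    _ = _ := by
      rw [hpow, Complex.ofReal_div, Complex.ofReal_pow]
      field_simp

theorem betaIntegral_eq_cBeta {u v : ℂ} (hu : 0 < u.re) (hv : 0 < v.re) :
    Complex.betaIntegral u v = cBeta u v := by
  have hne : Complex.Gamma (u + v) ≠ 0 :=
    Complex.Gamma_ne_zero_of_re_pos (by rw [Complex.add_re]; positivity)
  rw [cBeta, Complex.Gamma_mul_Gamma_eq_betaIntegral hu hv, mul_div_cancel_left₀ _ hne]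

theorem shiftedPowMellin_ofReal {n : ℕ} {s : ℂ} (h0 : 0 < s.re) (hn : s.re < n) {a : ℝ}
    (ha : 0 < a) : shiftedPowMellin n s a = (a : ℂ) ^ (s - n) * cBeta s (n - s) := by
  have ha0 : (a : ℂ) ≠ 0 := by exact_mod_cast ha.ne'
  rw [← betaIntegral_eq_cBeta h0 (by simpa using hn), betaIntegral_eq_shiftedPowMellin s ha,
    ← mul_assoc, ← Complex.cpow_add _ _ ha0, sub_add_sub_cancel, sub_self, Complex.cpow_zero,
    one_mul]

theorem shiftedPowMellin_eq {n : ℕ} {s a : ℂ} (h0 : 0 < s.re) (hn : s.re < n)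
    (ha : 0 < a.re + a.im) : shiftedPowMellin n s a = a ^ (s - n) * cBeta s (n - s) := by
  set U : Set ℂ := {z | 0 < z.re + z.im}
  have hL : Continuous fun z : ℂ => z.re + z.im := Complex.continuous_re.add Complex.continuous_im
  have hUo : IsOpen U := isOpen_lt continuous_const hL
  have hUc : Convex ℝ U :=
    convex_halfSpace_gt (Complex.reLm + Complex.imLm : ℂ →ₗ[ℝ] ℝ).isLinear 0
  have hslit : ∀ z ∈ U, z ∈ Complex.slitPlane := by
    intro z hz
    have hz' : 0 < z.re + z.im := hz
    rw [Complex.mem_slitPlane_iff]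
    by_contra! h
    linarith [h.1, h.2]
  have hF : AnalyticOnNhd ℂ (shiftedPowMellin n s) U :=
    DifferentiableOn.analyticOnNhd
      (fun z hz => (differentiableAt_shiftedPowMellin h0 hn hz).differentiableWithinAt) hUo
  have hG : AnalyticOnNhd ℂ (fun z : ℂ => z ^ (s - n) * cBeta s (n - s)) U :=
    DifferentiableOn.analyticOnNhd (fun z hz =>
      ((differentiableAt_id.cpow_const (hslit z hz)).mul_const _).differentiableWithinAt) hUo
  refine hF.eqOn_of_preconnected_of_frequently_eq hG hUc.isPreconnected (z₀ := 1)
    (by simp [U]) ?_ ha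
  have htend : Tendsto (fun x : ℝ => (x : ℂ)) (𝓝[≠] 1) (𝓝[≠] 1) := by
    refine tendsto_nhdsWithin_iff.2 ⟨?_, ?_⟩
    · exact (Complex.continuous_ofReal.tendsto' 1 1 Complex.ofReal_one).mono_left
        nhdsWithin_le_nhds
    · filter_upwards [self_mem_nhdsWithin] with x hx
      simpa using hx
  refine htend.frequently (Eventually.frequently ?_)
  filter_upwards [nhdsWithin_le_nhds (Ioi_mem_nhds zero_lt_one)] with x hx
  exact shiftedPowMellin_ofReal h0 hn hx

theorem I_mul_ofReal_cpow_sub_natCast (n : ℕ) (s : ℂ) {c : ℝ} (hc : 0 < c) :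
    (Complex.I * c) ^ (s - n) =
      Complex.exp (Complex.I * Real.pi * s / 2) * Complex.I ^ (-(n : ℤ)) *
        (c : ℂ) ^ (s - n) := by
  have hc0 : (c : ℂ) ≠ 0 := by exact_mod_cast hc.ne'
  have hlog : Complex.log (Complex.I * c) = Complex.log c + Real.pi / 2 * Complex.I := by
    rw [mul_comm, Complex.log_ofReal_mul hc Complex.I_ne_zero, Complex.log_I,
      Complex.ofReal_log hc.le]
  have hI : Complex.I ^ (-(n : ℤ)) = Complex.exp (Real.pi / 2 * Complex.I * -n) := by
    rw [← Complex.cpow_intCast, Complex.cpow_def_of_ne_zero Complex.I_ne_zero, Complex.log_I]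
    push_cast
    rfl
  rw [Complex.cpow_def_of_ne_zero (mul_ne_zero Complex.I_ne_zero hc0), hlog, hI,
    Complex.cpow_def_of_ne_zero hc0, ← Complex.exp_add, ← Complex.exp_add]
  congr 1
  ring

/-- identity (4.13) in the proof of Lemma 5.2 of the paper.  For `k` an even
positive integer, `y > 0` and `0 < Re s < k`,
`∫₀^∞ x^{s−1}(x+i(1+y))^{−k} dx = e^{iπs/2} i^{−k} (1+y)^{s−k} B(s, k−s)`. -/
theorem stmt_10 (k : ℕ) (hk : Even k) (hkpos : 0 < k) (y : ℝ) (hy : 0 < y)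
    (s : ℂ) (hs0 : 0 < s.re) (hsk : s.re < k) :
    (∫ x in Set.Ioi (0 : ℝ),
        (x : ℂ) ^ (s - 1) * ((x : ℂ) + Complex.I * (1 + (y : ℂ))) ^ (-(k : ℤ))) =
      Complex.exp (Complex.I * Real.pi * s / 2) * Complex.I ^ (-(k : ℤ)) *
        ((1 + y : ℝ) : ℂ) ^ (s - (k : ℂ)) * cBeta s ((k : ℂ) - s) := by
  have hc : 0 < 1 + y := by positivity
  have h := shiftedPowMellin_eq (a := Complex.I * (1 + y : ℝ)) hs0 hsk (by simpa using hc)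
  rw [I_mul_ofReal_cpow_sub_natCast k s hc, shiftedPowMellin] at h
  simpa only [Complex.ofReal_add, Complex.ofReal_one] using h
end

section
/- Let k be an even integer with k ≥ 4 and let t be a real number with t < 1 and t ≠ 0. Then the iterated integral ∫_0^∞ x^{k/2−1} ( ∫_0^∞ y^{k/2−1} (x y − t + i(x+y))^{−k} dy ) dx converges and equals B(k/2, k/2) · ∫_0^∞ x^{k/2−1} (x+i)^{−k/2} (i x − t)^{−k/2} dx. -/
open MeasureTheory Set

lemma norm_ofReal_le_norm_ofReal_add {c : ℂ} (hc : 0 ≤ c.re) {y : ℝ} (hy : 0 ≤ y) :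
    ‖(y : ℂ)‖ ≤ ‖(y : ℂ) + c‖ := by
  rw [Complex.norm_of_nonneg hy]
  refine le_trans ?_ (Complex.re_le_norm _)
  simpa using hc

lemma norm_le_norm_ofReal_add {c : ℂ} (hc : 0 ≤ c.re) {y : ℝ} (hy : 0 ≤ y) :
    ‖c‖ ≤ ‖(y : ℂ) + c‖ := by
  rw [← sq_le_sq₀ (norm_nonneg _) (norm_nonneg _), Complex.sq_norm, Complex.sq_norm,
    Complex.normSq_apply, Complex.normSq_apply]
  simp only [Complex.add_re, Complex.add_im, Complex.ofReal_re, Complex.ofReal_im, zero_add]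
  nlinarith [mul_nonneg hc hy, sq_nonneg y]

lemma ofReal_add_ne_zero_s11 {c : ℂ} (hc : 0 < c.re) {y : ℝ} (hy : 0 ≤ y) : (y : ℂ) + c ≠ 0 := by
  intro h
  have := congrArg Complex.re h
  simp only [Complex.add_re, Complex.ofReal_re, Complex.zero_re] at this
  linarith

lemma pow_mul_inv_pow_le {r s : ℝ} (hr : 0 ≤ r) (hs : 0 < s) (hrs : r ≤ s) (n p : ℕ) :
    r ^ n * (s ^ (n + p))⁻¹ ≤ (s ^ p)⁻¹ := by
  rw [pow_add, mul_inv, ← mul_assoc]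
  refine mul_le_of_le_one_left (by positivity) ?_
  rw [← div_eq_mul_inv]
  exact div_le_one_of_le₀ (by gcongr) (by positivity)

lemma integrableOn_pow_mul_inv_add_pow {c : ℂ} (hc : 0 < c.re) (j q : ℕ) :
    IntegrableOn (fun y : ℝ => (y : ℂ) ^ j * (((y : ℂ) + c) ^ (j + q + 2))⁻¹) (Ioi 0) := by
  have hc0 : 0 < ‖c‖ := hc.trans_le (Complex.re_le_norm c)
  refine Integrable.mono'
    (g := fun y : ℝ => ((‖c‖ ^ q)⁻¹ * (1 + (‖c‖ ^ 2)⁻¹)) * (1 + y ^ 2)⁻¹)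
    (integrable_inv_one_add_sq.const_mul _).integrableOn ?_ ?_
  · refine ContinuousOn.aestronglyMeasurable (fun y hy => ?_) measurableSet_Ioi
    have := ofReal_add_ne_zero_s11 hc (le_of_lt hy)
    exact ContinuousAt.continuousWithinAt (by fun_prop (disch := positivity))
  · filter_upwards [ae_restrict_mem measurableSet_Ioi] with y hy
    have hy : 0 < y := hy
    have h1 := norm_ofReal_le_norm_ofReal_add hc.le hy.le
    have h2 := norm_le_norm_ofReal_add hc.le hy.le
    have hs := hc0.trans_le h2
    have h3 := pow_mul_inv_pow_le (norm_nonneg _) hs h1 j (q + 2)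
    rw [norm_mul, norm_inv, norm_pow, norm_pow, add_assoc]
    refine h3.trans ?_
    rw [pow_add, mul_inv, mul_assoc]
    have h4 : (‖(y : ℂ) + c‖ ^ 2)⁻¹ ≤ (1 + (‖c‖ ^ 2)⁻¹) * (1 + y ^ 2)⁻¹ := by
      rw [Complex.norm_of_nonneg hy.le] at h1
      have h5 : ‖c‖ ^ 2 ≤ ‖(y : ℂ) + c‖ ^ 2 := by gcongr
      have h6 : y ^ 2 ≤ ‖(y : ℂ) + c‖ ^ 2 := by gcongr
      have h7 : 1 ≤ (‖c‖ ^ 2)⁻¹ * ‖(y : ℂ) + c‖ ^ 2 := by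
        rw [inv_mul_eq_div, one_le_div (by positivity)]; exact h5
      rw [← div_eq_mul_inv, inv_eq_one_div, div_le_div_iff₀ (by positivity) (by positivity)]
      linarith
    gcongr

lemma tendsto_pow_mul_inv_add_pow_atTop {c : ℂ} (hc : 0 < c.re) (j q : ℕ) :
    Filter.Tendsto (fun y : ℝ => (y : ℂ) ^ j * (((y : ℂ) + c) ^ (j + q + 1))⁻¹)
      Filter.atTop (nhds 0) := by
  have hc0 : 0 < ‖c‖ := hc.trans_le (Complex.re_le_norm c)
  have hlim : Filter.Tendsto (fun y : ℝ => (‖c‖ ^ q)⁻¹ * y⁻¹) Filter.atTop (nhds 0) := by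
    simpa using tendsto_inv_atTop_zero.const_mul ((‖c‖ ^ q)⁻¹)
  refine squeeze_zero_norm' ?_ hlim
  filter_upwards [Filter.eventually_gt_atTop 0] with y hy
  have h1 := norm_ofReal_le_norm_ofReal_add hc.le hy.le
  have h2 := norm_le_norm_ofReal_add hc.le hy.le
  have h3 := pow_mul_inv_pow_le (norm_nonneg _) (hc0.trans_le h2) h1 j (q + 1)
  rw [norm_mul, norm_inv, norm_pow, norm_pow, add_assoc]
  refine h3.trans ?_
  rw [Complex.norm_of_nonneg hy.le] at h1
  rw [pow_succ, mul_inv]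
  gcongr

lemma hasDerivAt_inv_add_pow {c : ℂ} {y : ℝ} (h : (y : ℂ) + c ≠ 0) (n : ℕ) :
    HasDerivAt (fun y : ℝ => (((y : ℂ) + c) ^ (n + 1))⁻¹)
      (-((n : ℂ) + 1) * (((y : ℂ) + c) ^ (n + 2))⁻¹) y := by
  have h0 : HasDerivAt (fun y : ℝ => (y : ℂ) + c) 1 y :=
    (HasDerivAt.ofReal_comp (hasDerivAt_id y)).add_const c
  refine ((h0.fun_pow (n + 1)).fun_inv (pow_ne_zero _ h)).congr_deriv ?_
  simp only [Nat.cast_add, Nat.cast_one, Nat.add_sub_cancel, mul_one]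
  field_simp
  ring

/-- The Beta integral `∫₀^∞ y^j (y + c)^{-(j + q + 2)} dy` for natural exponents. -/
lemma integral_pow_mul_inv_add_pow {c : ℂ} (hc : 0 < c.re) (q j : ℕ) :
    ∫ y in Ioi (0 : ℝ), (y : ℂ) ^ j * (((y : ℂ) + c) ^ (j + q + 2))⁻¹ =
      (j.factorial * q.factorial / (j + q + 1).factorial : ℂ) * (c ^ (q + 1))⁻¹ := by
  have hc0 : c ≠ 0 := by simpa using ofReal_add_ne_zero_s11 hc le_rfl
  induction j with
  | zero =>
    have hq : (q : ℂ) + 1 ≠ 0 := by exact_mod_cast q.succ_ne_zero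
    have h := integral_Ioi_of_hasDerivAt_of_tendsto'
      (fun y hy => hasDerivAt_inv_add_pow (ofReal_add_ne_zero_s11 hc hy) q)
      (by simpa [IntegrableOn] using (integrableOn_pow_mul_inv_add_pow hc 0 q).const_mul (-((q : ℂ) + 1)))
      (by simpa using tendsto_pow_mul_inv_add_pow_atTop hc 0 q)
    rw [integral_const_mul] at h
    simp only [Complex.ofReal_zero, zero_add, zero_sub] at h
    simp only [pow_zero, one_mul, zero_add, Nat.factorial_zero, Nat.cast_one,
      Nat.factorial_succ, Nat.cast_mul, Nat.cast_add]
    have hf : (q.factorial : ℂ) ≠ 0 := by exact_mod_cast q.factorial_ne_zero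
    rw [neg_mul, neg_inj] at h
    rw [← mul_right_inj' hq, h]
    field_simp
  | succ j ih =>
    have hj : (j : ℂ) + 1 + q + 1 ≠ 0 := by exact_mod_cast (j + 1 + q).succ_ne_zero
    have hi := (integrableOn_pow_mul_inv_add_pow hc j q).const_mul ((j : ℂ) + 1)
    have hi' := (integrableOn_pow_mul_inv_add_pow hc (j + 1) q).const_mul (-((j : ℂ) + 1 + q + 1))
    have hd : ∀ y ∈ Ici (0 : ℝ),
        HasDerivAt (fun y : ℝ => (y : ℂ) ^ (j + 1) * (((y : ℂ) + c) ^ (j + 1 + q + 1))⁻¹)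
          (((j : ℂ) + 1) * ((y : ℂ) ^ j * (((y : ℂ) + c) ^ (j + q + 2))⁻¹) +
            -((j : ℂ) + 1 + q + 1) *
              ((y : ℂ) ^ (j + 1) * (((y : ℂ) + c) ^ (j + 1 + q + 2))⁻¹)) y := by
      intro y hy
      refine (((HasDerivAt.ofReal_comp (hasDerivAt_id y)).fun_pow (j + 1)).fun_mul
        (hasDerivAt_inv_add_pow (ofReal_add_ne_zero_s11 hc hy) (j + 1 + q))).congr_deriv ?_
      rw [show j + 1 + q + 1 = j + q + 2 by ring]
      push_cast
      simp
      ring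
    have h := integral_Ioi_of_hasDerivAt_of_tendsto' hd (hi.add hi')
      (tendsto_pow_mul_inv_add_pow_atTop hc (j + 1) q)
    rw [integral_add hi hi', integral_const_mul, integral_const_mul, ih] at h
    simp only [Complex.ofReal_zero, ne_eq, Nat.add_eq_zero_iff, one_ne_zero, and_false,
      not_false_eq_true, zero_pow, zero_mul, sub_zero] at h
    rw [← mul_right_inj' hj, ← sub_eq_zero, ← neg_eq_zero]
    rw [← h, show j + 1 + q + 1 = (j + q + 1) + 1 by ring]
    have hf : ((j + q + 1).factorial : ℂ) ≠ 0 := by exact_mod_cast Nat.factorial_ne_zero _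
    have hj' : (j : ℂ) + q + 1 + 1 ≠ 0 := by convert hj using 1; ring
    simp only [Nat.factorial_succ (j + q + 1), Nat.factorial_succ j, Nat.cast_mul, Nat.cast_add,
      Nat.cast_one]
    field_simp
    ring

lemma cBeta_natCast_succ (n : ℕ) :
    cBeta ((n : ℂ) + 1) ((n : ℂ) + 1) =
      (n.factorial * n.factorial / (n + n + 1).factorial : ℂ) := by
  rw [cBeta, Complex.Gamma_nat_eq_factorial, ← Complex.Gamma_nat_eq_factorial (n + n + 1)]
  congr 2
  push_cast
  ring

lemma inv_mul_add_pow {a : ℂ} (ha : a ≠ 0) (b y : ℂ) (n p : ℕ) :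
    y ^ n * ((a * y + b) ^ p)⁻¹ = (a ^ p)⁻¹ * (y ^ n * ((y + b / a) ^ p)⁻¹) := by
  have : a * y + b = a * (y + b / a) := by field_simp
  rw [this, mul_pow, mul_inv]
  ring

lemma integrableOn_pow_mul_inv_mul_add_pow {a b : ℂ} (h : 0 < (b / a).re) (n : ℕ) :
    IntegrableOn (fun y : ℝ => (y : ℂ) ^ n * ((a * y + b) ^ (n + n + 2))⁻¹) (Ioi 0) := by
  have ha : a ≠ 0 := by rintro rfl; simp at h
  simp only [inv_mul_add_pow ha]
  exact (integrableOn_pow_mul_inv_add_pow h n n).const_mul _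

lemma integral_pow_mul_inv_mul_add_pow {a b : ℂ} (h : 0 < (b / a).re) (n : ℕ) :
    ∫ y in Ioi (0 : ℝ), (y : ℂ) ^ n * ((a * y + b) ^ (n + n + 2))⁻¹ =
      cBeta ((n : ℂ) + 1) ((n : ℂ) + 1) * ((a ^ (n + 1))⁻¹ * (b ^ (n + 1))⁻¹) := by
  have ha : a ≠ 0 := by rintro rfl; simp at h
  have hb : b ≠ 0 := by rintro rfl; simp at h
  simp only [inv_mul_add_pow ha]
  rw [integral_const_mul, integral_pow_mul_inv_add_pow h, cBeta_natCast_succ, mul_left_comm]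
  congr 1
  rw [div_pow]
  field_simp
  ring

lemma re_div_ofReal_add_I_pos {x t : ℝ} (hx : 0 < x) (ht : t < 1) :
    0 < ((Complex.I * x - t) / ((x : ℂ) + Complex.I)).re := by
  rw [Complex.div_re, Complex.normSq_apply]
  simp only [Complex.sub_re, Complex.mul_re, Complex.I_re, Complex.ofReal_re, Complex.I_im,
    Complex.ofReal_im, Complex.add_re, Complex.sub_im, Complex.mul_im, Complex.add_im]
  rw [← add_div]
  apply div_pos
  · nlinarith
  · nlinarith

lemma integrableOn_pow_mul_inv_pow_mul_inv_pow {t : ℝ} (ht : t ≠ 0) (n : ℕ) :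
    IntegrableOn (fun x : ℝ => (x : ℂ) ^ n * (((x : ℂ) + Complex.I) ^ (n + 1))⁻¹ *
      ((Complex.I * x - t) ^ (n + 1))⁻¹) (Ioi 0) := by
  have hA : ∀ x : ℝ, ‖(x : ℂ) + Complex.I‖ ^ 2 = 1 + x ^ 2 := fun x => by
    rw [Complex.sq_norm, Complex.normSq_apply]; simp; ring
  have hB : ∀ x : ℝ, ‖Complex.I * x - t‖ ^ 2 = t ^ 2 + x ^ 2 := fun x => by
    rw [Complex.sq_norm, Complex.normSq_apply]; simp; ring
  have ht2 : 0 < t ^ 2 := by positivity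
  have hA0 : ∀ x : ℝ, 0 < ‖(x : ℂ) + Complex.I‖ := fun x =>
    (norm_nonneg _).lt_of_ne' fun h => by
      have := hA x
      rw [h] at this
      nlinarith [sq_nonneg x]
  have hB0 : ∀ x : ℝ, 0 < ‖Complex.I * x - t‖ := fun x =>
    (norm_nonneg _).lt_of_ne' fun h => by
      have := hB x
      rw [h] at this
      nlinarith [sq_nonneg x]
  refine Integrable.mono'
    (g := fun y : ℝ => ((|t| ^ n)⁻¹ * (1 + (t ^ 2)⁻¹)) * (1 + y ^ 2)⁻¹)
    (integrable_inv_one_add_sq.const_mul _).integrableOn ?_ ?_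
  · refine Continuous.aestronglyMeasurable ?_
    have h1 := fun x => pow_ne_zero (n + 1) (norm_pos_iff.1 (hA0 x))
    have h2 := fun x => pow_ne_zero (n + 1) (norm_pos_iff.1 (hB0 x))
    fun_prop (disch := assumption)
  · filter_upwards [ae_restrict_mem measurableSet_Ioi] with x hx
    have hx : 0 < x := hx
    have hxA : ‖(x : ℂ)‖ ≤ ‖(x : ℂ) + Complex.I‖ := by
      rw [Complex.norm_of_nonneg hx.le]
      exact abs_le_of_sq_le_sq' (by rw [hA]; linarith) (norm_nonneg _) |>.2
    have htB : |t| ≤ ‖Complex.I * x - t‖ :=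
      abs_le_of_sq_le_sq' (by rw [hB, sq_abs]; nlinarith) (norm_nonneg _) |>.2
    have h3 := pow_mul_inv_pow_le (norm_nonneg _) (hA0 x) hxA n 1
    rw [norm_mul, norm_mul, norm_inv, norm_inv, norm_pow, norm_pow, norm_pow]
    have ht0 : 0 < |t| := abs_pos.2 ht
    have hb : ‖Complex.I * x - t‖⁻¹ ≤ (1 + (t ^ 2)⁻¹) * ‖(x : ℂ) + Complex.I‖⁻¹ := by
      rw [← div_eq_mul_inv, inv_eq_one_div, div_le_div_iff₀ (hB0 x) (hA0 x), one_mul]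
      refine abs_le_of_sq_le_sq' ?_ (by positivity) |>.2
      rw [mul_pow, hA, hB]
      have h5 : (t ^ 2)⁻¹ * t ^ 2 = 1 := inv_mul_cancel₀ ht2.ne'
      have hu : 0 < (t ^ 2)⁻¹ := by positivity
      generalize (t ^ 2)⁻¹ = u at *
      nlinarith [mul_nonneg hu.le (sq_nonneg x), mul_nonneg (sq_nonneg u) (sq_nonneg x)]
    calc _ ≤ (‖(x : ℂ) + Complex.I‖ ^ 1)⁻¹ * ((|t| ^ n)⁻¹ * ‖Complex.I * x - t‖⁻¹) := by
          rw [pow_succ ‖Complex.I * x - t‖, mul_inv]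
          gcongr
      _ ≤ (‖(x : ℂ) + Complex.I‖ ^ 1)⁻¹ *
          ((|t| ^ n)⁻¹ * ((1 + (t ^ 2)⁻¹) * ‖(x : ℂ) + Complex.I‖⁻¹)) := by gcongr
      _ = _ := by rw [← hA]; ring

/-- the reduction (1.7′) in the proof of Lemma 7.4 of the paper.
For `k` even, `k ≥ 4`, and real `t < 1`, `t ≠ 0`, the iterated integral
`∫₀^∞ x^{k/2−1} (∫₀^∞ y^{k/2−1}(xy−t+i(x+y))^{−k} dy) dx` converges and equals
`B(k/2,k/2) ∫₀^∞ x^{k/2−1}(x+i)^{−k/2}(ix−t)^{−k/2} dx`. -/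
theorem stmt_11 (k : ℕ) (hk : Even k) (hk4 : 4 ≤ k) (t : ℝ) (ht : t < 1) (ht0 : t ≠ 0) :
    (∀ x ∈ Ioi (0 : ℝ), IntegrableOn (fun y : ℝ =>
        (y : ℂ) ^ (k / 2 - 1) *
          ((x : ℂ) * (y : ℂ) - (t : ℂ) + Complex.I * ((x : ℂ) + (y : ℂ))) ^ (-(k : ℤ)))
        (Ioi 0)) ∧
    IntegrableOn (fun x : ℝ => (x : ℂ) ^ (k / 2 - 1) * ∫ y in Ioi (0 : ℝ),
        (y : ℂ) ^ (k / 2 - 1) *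
          ((x : ℂ) * (y : ℂ) - (t : ℂ) + Complex.I * ((x : ℂ) + (y : ℂ))) ^ (-(k : ℤ)))
      (Ioi 0) ∧
    (∫ x in Ioi (0 : ℝ), (x : ℂ) ^ (k / 2 - 1) * ∫ y in Ioi (0 : ℝ),
        (y : ℂ) ^ (k / 2 - 1) *
          ((x : ℂ) * (y : ℂ) - (t : ℂ) + Complex.I * ((x : ℂ) + (y : ℂ))) ^ (-(k : ℤ))) =
      cBeta ((k : ℂ) / 2) ((k : ℂ) / 2) *
        ∫ x in Ioi (0 : ℝ), (x : ℂ) ^ (k / 2 - 1) *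
          ((x : ℂ) + Complex.I) ^ (-((k : ℤ) / 2)) *
          (Complex.I * (x : ℂ) - (t : ℂ)) ^ (-((k : ℤ) / 2)) := by
  obtain ⟨m, rfl⟩ := hk
  obtain ⟨n, rfl⟩ : ∃ n, m = n + 1 := ⟨m - 1, by omega⟩
  have e1 : (n + 1 + (n + 1)) / 2 - 1 = n := by omega
  have e2 : -(((n + 1 + (n + 1) : ℕ) : ℤ) / 2) = -((n + 1 : ℕ) : ℤ) := by omega
  have e3 : ((n + 1 + (n + 1) : ℕ) : ℂ) / 2 = (n : ℂ) + 1 := by push_cast; ring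
  have e4 : ∀ x y : ℂ, x * y - t + Complex.I * (x + y) =
      (x + Complex.I) * y + (Complex.I * x - t) := fun x y => by ring
  have e5 : n + 1 + (n + 1) = n + n + 2 := by ring
  rw [e1, e2, e3]
  simp only [zpow_neg, zpow_natCast, e4, e5]
  have key : ∀ x ∈ Ioi (0 : ℝ), (x : ℂ) ^ n * (∫ y in Ioi (0 : ℝ), (y : ℂ) ^ n *
      ((((x : ℂ) + Complex.I) * y + (Complex.I * x - t)) ^ (n + n + 2))⁻¹) =
      cBeta ((n : ℂ) + 1) ((n : ℂ) + 1) * ((x : ℂ) ^ n * (((x : ℂ) + Complex.I) ^ (n + 1))⁻¹ *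
        ((Complex.I * x - t) ^ (n + 1))⁻¹) := fun x hx => by
    rw [integral_pow_mul_inv_mul_add_pow (re_div_ofReal_add_I_pos hx ht)]
    ring
  refine ⟨fun x hx => integrableOn_pow_mul_inv_mul_add_pow (re_div_ofReal_add_I_pos hx ht) n,
    ?_, ?_⟩
  · rw [integrableOn_congr_fun key measurableSet_Ioi]
    exact (integrableOn_pow_mul_inv_pow_mul_inv_pow ht0 n).const_mul _
  · rw [setIntegral_congr_fun measurableSet_Ioi key, integral_const_mul]
end

section
/- Let k be an even integer with k ≥ 4, let t > 0 be real, and let s ∈ ℂ with −k/2 < Re(s) < k/2. Then ∫_0^∞ a^{s + k/2 − 1} (a − i)^{−k} exp( −2π t^{−1} / (a − i) ) da = i^k · e^{−2πi/t} · e^{−iπ(s + k/2)/2} · ∫_0^1 e^{2πi a / t} a^{s + k/2 − 1} (1−a)^{k/2 − s − 1} da. -/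
open MeasureTheory Set

open Filter Topology intervalIntegral in
/-- The integral of a holomorphic function over a horizontal line does not change when the line is
moved within a strip on which the function is dominated by a decaying integrable function of the
real part. -/
theorem integral_add_mul_I_eq_of_norm_le {E : Type*} [NormedAddCommGroup E] [NormedSpace ℂ E]
    [CompleteSpace E] {f : ℂ → E} {y₁ y₂ : ℝ} {φ : ℝ → ℝ}
    (hf : DifferentiableOn ℂ f (univ ×ℂ (uIcc y₁ y₂)))
    (hbound : ∀ x : ℝ, ∀ y ∈ uIcc y₁ y₂, ‖f (x + y * Complex.I)‖ ≤ φ x)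
    (hφ : Integrable φ) (hbot : Tendsto φ atBot (𝓝 0)) (htop : Tendsto φ atTop (𝓝 0)) :
    ∫ x : ℝ, f (x + y₁ * Complex.I) = ∫ x : ℝ, f (x + y₂ * Complex.I) := by
  have hint : ∀ y ∈ uIcc y₁ y₂, Integrable fun x : ℝ => f (x + y * Complex.I) := by
    intro y hy
    refine hφ.mono' (Continuous.aestronglyMeasurable ?_) (ae_of_all _ fun x => hbound x y hy)
    refine hf.continuousOn.comp_continuous (by fun_prop) fun x => ?_
    simpa [Complex.mem_reProdIm] using hy
  have hside : ∀ {l : Filter ℝ}, Tendsto φ l (𝓝 0) →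
      Tendsto (fun T : ℝ => ∫ y in y₁..y₂, f (T + y * Complex.I)) l (𝓝 0) := by
    intro l hl
    refine squeeze_zero_norm (fun T => ?_) (by simpa using hl.mul_const |y₂ - y₁|)
    exact norm_integral_le_of_norm_le_const fun y hy => hbound T y (uIoc_subset_uIcc hy)
  have hline : ∀ y ∈ uIcc y₁ y₂, Tendsto (fun T : ℝ => ∫ x in -T..T, f (x + y * Complex.I)) atTop
      (𝓝 (∫ x : ℝ, f (x + y * Complex.I))) := fun y hy =>
    intervalIntegral_tendsto_integral (hint y hy) tendsto_neg_atTop_atBot tendsto_id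
  have hrect : ∀ T : ℝ, (∫ x in -T..T, f (x + y₁ * Complex.I)) -
      (∫ x in -T..T, f (x + y₂ * Complex.I)) +
      Complex.I • (∫ y in y₁..y₂, f (T + y * Complex.I)) -
      Complex.I • (∫ y in y₁..y₂, f ((-T : ℝ) + y * Complex.I)) = 0 := by
    intro T
    have := Complex.integral_boundary_rect_eq_zero_of_differentiableOn f
      ((-T : ℝ) + y₁ * Complex.I) (T + y₂ * Complex.I) (hf.mono ?_)
    · simpa using this
    · intro z hz
      rw [Complex.mem_reProdIm] at hz ⊢
      exact ⟨mem_univ _, by simpa using hz.2⟩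
  have hlim := (((hline y₁ left_mem_uIcc).sub (hline y₂ right_mem_uIcc)).add
    ((hside htop).const_smul Complex.I)).sub
    (((hside hbot).comp tendsto_neg_atTop_atBot).const_smul Complex.I)
  refine sub_eq_zero.mp (tendsto_nhds_unique ?_ tendsto_const_nhds (l := atTop)
    (f := fun _ : ℝ => (0 : E)))
  simpa [hrect] using hlim.congr hrect

theorem integrable_exp_neg_mul_abs {δ : ℝ} (hδ : 0 < δ) :
    Integrable fun x : ℝ => Real.exp (-δ * |x|) := by
  rw [← integrableOn_univ, ← Iic_union_Ioi (a := (0 : ℝ))]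
  refine IntegrableOn.union ?_ ?_
  · refine (integrableOn_exp_mul_Iic hδ 0).congr_fun (fun x hx => ?_) measurableSet_Iic
    simp [abs_of_nonpos (mem_Iic.mp hx)]
  · refine (integrableOn_exp_mul_Ioi (neg_lt_zero.mpr hδ) 0).congr_fun (fun x hx => ?_)
      measurableSet_Ioi
    simp [abs_of_pos (mem_Ioi.mp hx)]

theorem one_le_norm_sub_I {z : ℂ} (hz : z.im ≤ 0) : 1 ≤ ‖z - Complex.I‖ := by
  refine le_trans ?_ (Complex.abs_im_le_norm _)
  rw [Complex.sub_im, Complex.I_im, abs_of_nonpos (by linarith)]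
  linarith

theorem norm_le_norm_sub_I {z : ℂ} (hz : z.im ≤ 0) : ‖z‖ ≤ ‖z - Complex.I‖ := by
  rw [Complex.norm_def, Complex.norm_def]
  apply Real.sqrt_le_sqrt
  simp only [Complex.normSq_apply, Complex.sub_re, Complex.sub_im, Complex.I_re, Complex.I_im]
  nlinarith

/-- The integrand `a ^ w * (a - i) ^ (-k) * exp (-c / (a - i))` of a Mellin integral, in the
logarithmic coordinate `a = exp z`. -/
noncomputable def logMellinIntegrand (k : ℕ) (c w z : ℂ) : ℂ :=
  Complex.exp (w * z) * (Complex.exp z - Complex.I) ^ (-(k : ℤ)) *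
    Complex.exp (-c / (Complex.exp z - Complex.I))

theorem exp_im_nonpos {z : ℂ} (hz : z.im ∈ uIcc 0 (-(Real.pi / 2))) : (Complex.exp z).im ≤ 0 := by
  rw [uIcc_of_ge (by linarith [Real.pi_pos])] at hz
  rw [Complex.exp_im]
  exact mul_nonpos_of_nonneg_of_nonpos (Real.exp_nonneg _)
    (Real.sin_nonpos_of_nonpos_of_neg_pi_le hz.2 (by linarith [hz.1, Real.pi_pos]))

theorem differentiableOn_logMellinIntegrand (k : ℕ) (c w : ℂ) :
    DifferentiableOn ℂ (logMellinIntegrand k c w) (univ ×ℂ (uIcc 0 (-(Real.pi / 2)))) := by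
  intro z hz
  have hne : Complex.exp z - Complex.I ≠ 0 :=
    norm_pos_iff.mp (one_pos.trans_le (one_le_norm_sub_I (exp_im_nonpos hz.2)))
  have hd : DifferentiableAt ℂ (fun z => Complex.exp z - Complex.I) z := by fun_prop
  refine DifferentiableAt.differentiableWithinAt ?_
  unfold logMellinIntegrand
  exact ((by fun_prop : DifferentiableAt ℂ (fun z => Complex.exp (w * z)) z).mul
    (hd.zpow (Or.inl hne))).mul ((differentiableAt_const _).div hd hne).cexp

theorem norm_logMellinIntegrand_le {k : ℕ} {c w : ℂ} {δ x y : ℝ} (hδ : δ ≤ w.re)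
    (hδk : δ ≤ k - w.re) (hy : y ∈ uIcc 0 (-(Real.pi / 2))) :
    ‖logMellinIntegrand k c w (x + y * Complex.I)‖ ≤
      Real.exp (|w.im| * (Real.pi / 2) + ‖c‖) * Real.exp (-δ * |x|) := by
  set z : ℂ := x + y * Complex.I with hz
  have hre : z.re = x := by simp [hz]
  have him : z.im = y := by simp [hz]
  have hexp : (Complex.exp z).im ≤ 0 := exp_im_nonpos (him ▸ hy)
  have hone := one_le_norm_sub_I hexp
  have hge := norm_le_norm_sub_I hexp
  rw [Complex.norm_exp, hre] at hge
  have hpos : 0 < ‖Complex.exp z - Complex.I‖ := one_pos.trans_le hone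
  have hy' : |y| ≤ Real.pi / 2 := by
    rw [uIcc_of_ge (by linarith [Real.pi_pos])] at hy
    rw [abs_of_nonpos hy.2]
    linarith [hy.1]
  have hpow : Real.exp (w.re * x) * ‖Complex.exp z - Complex.I‖ ^ (-(k : ℤ)) ≤
      Real.exp (-δ * |x|) := by
    rw [zpow_neg, zpow_natCast, ← div_eq_mul_inv, div_le_iff₀ (pow_pos hpos k)]
    rcases le_total x 0 with hx | hx
    · rw [abs_of_nonpos hx]
      calc Real.exp (w.re * x) ≤ Real.exp (-δ * -x) := Real.exp_le_exp.mpr (by nlinarith)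
        _ ≤ _ := le_mul_of_one_le_right (Real.exp_nonneg _) (one_le_pow₀ hone)
    · rw [abs_of_nonneg hx]
      calc Real.exp (w.re * x) ≤ Real.exp (-δ * x) * Real.exp x ^ k := by
            rw [← Real.exp_nat_mul, ← Real.exp_add]
            exact Real.exp_le_exp.mpr (by nlinarith)
        _ ≤ _ := by gcongr
  have harg : ‖Complex.exp (-c / (Complex.exp z - Complex.I))‖ ≤ Real.exp ‖c‖ := by
    rw [Complex.norm_exp]
    refine Real.exp_le_exp.mpr ((Complex.re_le_norm _).trans ?_)
    rw [norm_div, norm_neg]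
    exact div_le_self (norm_nonneg _) hone
  have hw : ‖Complex.exp (w * z)‖ ≤ Real.exp (w.re * x) * Real.exp (|w.im| * (Real.pi / 2)) := by
    rw [Complex.norm_exp, Complex.mul_re, hre, him, ← Real.exp_add]
    refine Real.exp_le_exp.mpr ?_
    have h := neg_le_abs (w.im * y)
    rw [abs_mul] at h
    nlinarith [mul_le_mul_of_nonneg_left hy' (abs_nonneg w.im)]
  rw [logMellinIntegrand, norm_mul, norm_mul, norm_zpow]
  calc _ ≤ Real.exp (w.re * x) * Real.exp (|w.im| * (Real.pi / 2)) *
        ‖Complex.exp z - Complex.I‖ ^ (-(k : ℤ)) * Real.exp ‖c‖ := by gcongr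
    _ = Real.exp (|w.im| * (Real.pi / 2) + ‖c‖) *
        (Real.exp (w.re * x) * ‖Complex.exp z - Complex.I‖ ^ (-(k : ℤ))) := by
      rw [Real.exp_add]; ring
    _ ≤ _ := by gcongr

open Filter Topology in
theorem integral_logMellinIntegrand_rotate {k : ℕ} {c w : ℂ} (h0 : 0 < w.re) (hk : w.re < k) :
    ∫ x : ℝ, logMellinIntegrand k c w x =
      ∫ x : ℝ, logMellinIntegrand k c w (x + (-(Real.pi / 2) : ℝ) * Complex.I) := by
  have hδ : 0 < min w.re (k - w.re) := lt_min h0 (sub_pos.mpr hk)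
  have hlim : ∀ {l : Filter ℝ}, Tendsto (fun x : ℝ => |x|) l atTop → Tendsto (fun x : ℝ =>
      Real.exp (|w.im| * (Real.pi / 2) + ‖c‖) * Real.exp (-min w.re (k - w.re) * |x|)) l
      (𝓝 0) := by
    intro l hl
    simpa using (Real.tendsto_exp_atBot.comp
      (hl.const_mul_atTop_of_neg (neg_lt_zero.mpr hδ))).const_mul
      (Real.exp (|w.im| * (Real.pi / 2) + ‖c‖))
  simpa using integral_add_mul_I_eq_of_norm_le (differentiableOn_logMellinIntegrand k c w)
    (fun x y hy => norm_logMellinIntegrand_le (min_le_left _ _) (min_le_right _ _) hy)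
    ((integrable_exp_neg_mul_abs hδ).const_mul _) (hlim tendsto_abs_atBot_atTop)
    (hlim tendsto_abs_atTop_atTop)

theorem integral_Ioi_eq_integral_exp_smul {E : Type*} [NormedAddCommGroup E] [NormedSpace ℝ E]
    (g : ℝ → E) : ∫ a in Ioi (0 : ℝ), g a = ∫ x : ℝ, Real.exp x • g (Real.exp x) := by
  rw [← Real.range_exp, ← image_univ, integral_image_eq_integral_abs_deriv_smul MeasurableSet.univ
    (fun x _ => (Real.hasDerivAt_exp x).hasDerivWithinAt) Real.exp_injective.injOn]
  simp

theorem integral_Ioo_eq_integral_sigmoid_smul {E : Type*} [NormedAddCommGroup E]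
    [NormedSpace ℝ E] (g : ℝ → E) : ∫ a in Ioo (0 : ℝ) 1, g a =
      ∫ x : ℝ, (Real.sigmoid x * (1 - Real.sigmoid x)) • g (Real.sigmoid x) := by
  rw [← Real.range_sigmoid, ← image_univ, integral_image_eq_integral_abs_deriv_smul
    MeasurableSet.univ (fun x _ => (Real.hasDerivAt_sigmoid x).hasDerivWithinAt)
    Real.sigmoid_injective.injOn, setIntegral_univ]
  refine integral_congr_ae (ae_of_all _ fun x => ?_)
  simp only
  rw [abs_of_nonneg (mul_nonneg (Real.sigmoid_nonneg x) (sub_nonneg.mpr (Real.sigmoid_le_one x)))]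

theorem ofReal_exp_cpow (x : ℝ) (w : ℂ) : ((Real.exp x : ℝ) : ℂ) ^ w = Complex.exp (w * x) := by
  rw [Complex.cpow_def_of_ne_zero (by exact_mod_cast (Real.exp_pos x).ne'), ← Complex.ofReal_log
    (Real.exp_pos x).le, Real.log_exp, mul_comm]

/-- On the line `Im z = -π / 2` the logarithmic Mellin integrand is a Beta-type integrand evaluated
at the sigmoid of the real part. -/
theorem logMellinIntegrand_neg_pi_div_two (k : ℕ) (c w : ℂ) (x : ℝ) :
    logMellinIntegrand k c w (x + (-(Real.pi / 2) : ℝ) * Complex.I) =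
      Complex.I ^ k * Complex.exp (-(c * Complex.I)) *
        Complex.exp (-(Complex.I * Real.pi * w / 2)) *
        ((Real.sigmoid x * (1 - Real.sigmoid x)) •
          (Complex.exp (c * Complex.I * Real.sigmoid x) * (Real.sigmoid x : ℂ) ^ (w - 1) *
            ((1 - Real.sigmoid x : ℝ) : ℂ) ^ (k - w - 1))) := by
  have hu := Real.sigmoid_pos x
  have hv : 0 < 1 - Real.sigmoid x := sub_pos.mpr (Real.sigmoid_lt_one x)
  set u := Real.sigmoid x with hu_def
  set v := 1 - u with hv_def
  have huv : u = Real.exp x * v := by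
    rw [hv_def, hu_def, Real.sigmoid_def, Real.exp_neg]
    have := Real.exp_pos x
    field_simp
    ring
  have hvx : (1 + Real.exp x) * v = 1 := by linear_combination -huv + hv_def
  have hvx' : (1 + Complex.exp x) * (v : ℂ) = 1 := by exact_mod_cast congrArg Complex.ofReal hvx
  have huC : (u : ℂ) ≠ 0 := by exact_mod_cast hu.ne'
  have hvC : (v : ℂ) ≠ 0 := by exact_mod_cast hv.ne'
  have hexp : Complex.exp (x + (-(Real.pi / 2) : ℝ) * Complex.I) - Complex.I =
      (Complex.I * v)⁻¹ := by
    have h : Complex.exp ((-(Real.pi / 2) : ℝ) * Complex.I) = -Complex.I := by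
      push_cast
      rw [← neg_div, Complex.exp_neg_pi_div_two_mul_I]
    rw [Complex.exp_add, h, mul_inv, Complex.inv_I, eq_mul_inv_iff_mul_eq₀ hvC]
    linear_combination -Complex.I * hvx'
  have hupow : (u : ℂ) ^ w = Complex.exp (w * x) * (v : ℂ) ^ w := by
    rw [huv, Complex.ofReal_mul, Complex.mul_cpow_ofReal_nonneg (Real.exp_nonneg _) hv.le,
      ofReal_exp_cpow]
  have hvu : (v : ℂ) = 1 - u := by rw [hv_def]; push_cast; ring
  have hw : Complex.exp (w * (x + (-(Real.pi / 2) : ℝ) * Complex.I)) =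
      Complex.exp (w * x) * Complex.exp (-(Complex.I * Real.pi * w / 2)) := by
    rw [← Complex.exp_add]
    congr 1
    push_cast
    ring
  have hc : Complex.exp (-c / (Complex.I * v)⁻¹) =
      Complex.exp (-(c * Complex.I)) * Complex.exp (c * Complex.I * u) := by
    rw [← Complex.exp_add, div_inv_eq_mul, hvu]
    congr 1
    ring
  have hvw : (v : ℂ) ^ w ≠ 0 := by simp [Complex.cpow_eq_zero_iff, hvC]
  rw [logMellinIntegrand, hexp, hw, hc, zpow_neg, zpow_natCast, inv_pow, inv_inv, mul_pow,
    Complex.cpow_sub _ _ huC, Complex.cpow_sub _ _ hvC, Complex.cpow_sub _ _ hvC,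
    Complex.cpow_one, Complex.cpow_one, Complex.cpow_natCast, hupow, Complex.real_smul]
  push_cast
  field_simp

/-- the contour-rotation identity in Section 9.5.4 of the paper.
For `k` even, `k ≥ 4`, real `t > 0` and `−k/2 < Re s < k/2`,
`∫₀^∞ a^{s+k/2−1}(a−i)^{−k} exp(−2πt⁻¹/(a−i)) da
  = i^k e^{−2πi/t} e^{−iπ(s+k/2)/2} ∫₀^1 e^{2πia/t} a^{s+k/2−1}(1−a)^{k/2−s−1} da`. -/
theorem stmt_15 (k : ℕ) (hk : Even k) (hk4 : 4 ≤ k) (t : ℝ) (ht : 0 < t)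
    (s : ℂ) (h1 : -(k : ℝ) / 2 < s.re) (h2 : s.re < (k : ℝ) / 2) :
    (∫ a in Ioi (0 : ℝ), (a : ℂ) ^ (s + (k : ℂ) / 2 - 1) * ((a : ℂ) - Complex.I) ^ (-(k : ℤ)) *
        Complex.exp (-(2 * Real.pi * ((t : ℂ))⁻¹) / ((a : ℂ) - Complex.I))) =
      Complex.I ^ k * Complex.exp (-(2 * Real.pi * Complex.I / t)) *
        Complex.exp (-(Complex.I * Real.pi * (s + (k : ℂ) / 2) / 2)) *
        ∫ a in Ioo (0 : ℝ) 1, Complex.exp (2 * Real.pi * Complex.I * a / t) *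
          (a : ℂ) ^ (s + (k : ℂ) / 2 - 1) * ((1 - a : ℝ) : ℂ) ^ ((k : ℂ) / 2 - s - 1) := by
  have hw0 : 0 < (s + (k : ℂ) / 2).re := by
    rw [Complex.add_re, Complex.div_ofNat_re, Complex.natCast_re]
    linarith
  have hwk : (s + (k : ℂ) / 2).re < k := by
    rw [Complex.add_re, Complex.div_ofNat_re, Complex.natCast_re]
    linarith
  have hrot := integral_logMellinIntegrand_rotate (c := 2 * Real.pi * (t : ℂ)⁻¹) hw0 hwk
  rw [integral_Ioi_eq_integral_exp_smul, integral_Ioo_eq_integral_sigmoid_smul,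
    ← integral_const_mul]
  refine (integral_congr_ae (ae_of_all _ fun x => ?_)).trans
    (hrot.trans (integral_congr_ae (ae_of_all _ fun x => ?_)))
  · have hx : (Real.exp x : ℂ) ≠ 0 := by exact_mod_cast (Real.exp_pos x).ne'
    rw [logMellinIntegrand, Complex.real_smul, Complex.cpow_sub _ _ hx, Complex.cpow_one,
      ofReal_exp_cpow, ← Complex.ofReal_exp]
    field_simp
  · simp only
    rw [logMellinIntegrand_neg_pi_div_two]
    congr! 4 <;> ring_nf
end
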